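/- arXiv:0902.3777 — 9 statements merged into one kernel-verified Lean document; each statement's English description precedes it below -/
import Mathlib

section
/- For every integer n ≥ 1, the row vector Y_n := ( √(G_n(F_n+G_n)⁻¹) , √(F_n(F_n+G_n)⁻¹)·𝔖ⁿ ) with entries in B(H ⊕ H) satisfies Y_n Y_n* = SⁿS*ⁿ ⊕ 1 (the operator E_n on H ⊕ H) and Y_n* Y_n = Q_n, where Q_n is the 2×2 operator matrix with entries (Q_n)₁₁ = G_n(F_n+G_n)⁻¹, (Q_n)₁₂ = √(F_nG_n)(F_n+G_n)⁻¹𝔖ⁿ, (Q_n)₂₁ = √(f_n(ζ)g_n(ζ))(f_n(ζ)+g_n(ζ))⁻¹𝔖*ⁿ, (Q_n)₂₂ = f_n(ζ)(f_n(ζ)+g_n(ζ))⁻¹. In particular the projections E_n and Q_n are Murray–von Neumann equivalent. -/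
set_option synthInstance.maxHeartbeats 1000000
set_option maxHeartbeats 1000000

/-- `T` is diagonal with real eigenvalues `a` along the family `e`. -/
def IsDiagonalOn {ι K : Type*} [NormedAddCommGroup K] [InnerProductSpace ℂ K]
    (e : ι → K) (T : K →L[ℂ] K) (a : ι → ℝ) : Prop :=
  ∀ i, T (e i) = (a i : ℂ) • e i

section Total

variable {ι K : Type*} [NormedAddCommGroup K] [InnerProductSpace ℂ K] {e : ι → K}

theorem ext_of_total (ht : (Submodule.span ℂ (Set.range e)).topologicalClosure = ⊤)
    {A B : K →L[ℂ] K} (h : ∀ i, A (e i) = B (e i)) : A = B := by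
  refine ContinuousLinearMap.ext_on (s := Set.range e) ?_ ?_
  · exact Submodule.dense_iff_topologicalClosure_eq_top.mpr ht
  · rintro _ ⟨i, rfl⟩
    exact h i

theorem eq_of_inner_total (ht : (Submodule.span ℂ (Set.range e)).topologicalClosure = ⊤)
    {x y : K} (h : ∀ i, inner ℂ (e i) x = inner ℂ (e i) y) : x = y := by
  have hAB : innerSL ℂ x = innerSL ℂ y := by
    refine ContinuousLinearMap.ext_on (s := Set.range e)
      (Submodule.dense_iff_topologicalClosure_eq_top.mpr ht) ?_
    rintro _ ⟨i, rfl⟩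
    have := congrArg (starRingEnd ℂ) (h i)
    simpa only [inner_conj_symm, innerSL_apply_apply] using this
  refine ext_inner_right ℂ fun v => ?_
  exact congrArg (fun f : K →L[ℂ] ℂ => f v) hAB

namespace IsDiagonalOn

variable {T U : K →L[ℂ] K} {a b : ι → ℝ}

theorem one : IsDiagonalOn e (1 : K →L[ℂ] K) fun _ => 1 := fun i => by simp

theorem add (hT : IsDiagonalOn e T a) (hU : IsDiagonalOn e U b) :
    IsDiagonalOn e (T + U) fun i => a i + b i := fun i => by
  simp [hT i, hU i, add_smul]

theorem sub (hT : IsDiagonalOn e T a) (hU : IsDiagonalOn e U b) :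
    IsDiagonalOn e (T - U) fun i => a i - b i := fun i => by
  simp [hT i, hU i, sub_smul]

theorem smul (c : ℝ) (hT : IsDiagonalOn e T a) :
    IsDiagonalOn e ((c : ℂ) • T) fun i => c * a i := fun i => by
  simp [hT i, mul_smul]

theorem mul (hT : IsDiagonalOn e T a) (hU : IsDiagonalOn e U b) :
    IsDiagonalOn e (T * U) fun i => a i * b i := fun i => by
  rw [mul_apply_eq_comp, hU i, map_smul, hT i, smul_smul, mul_comm, Complex.ofReal_mul]

theorem list_prod_range {T : ℕ → K →L[ℂ] K} {a : ℕ → ι → ℝ}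
    (h : ∀ k, IsDiagonalOn e (T k) (a k)) (n : ℕ) :
    IsDiagonalOn e ((List.range n).map T).prod fun i => ∏ k ∈ Finset.range n, a k i := by
  induction n with
  | zero => simpa using one
  | succ n ih =>
    simpa [List.range_succ, Finset.prod_range_succ] using ih.mul (h n)

theorem eq (ht : (Submodule.span ℂ (Set.range e)).topologicalClosure = ⊤)
    (hT : IsDiagonalOn e T a) (hU : IsDiagonalOn e U a) : T = U :=
  ext_of_total ht fun i => (hT i).trans (hU i).symm

variable [CompleteSpace K]

theorem isSelfAdjoint (he : Orthonormal ℂ e)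
    (ht : (Submodule.span ℂ (Set.range e)).topologicalClosure = ⊤)
    (hT : IsDiagonalOn e T a) : star T = T := by
  classical
  refine ext_of_total ht fun i => eq_of_inner_total ht fun j => ?_
  rw [ContinuousLinearMap.star_eq_adjoint, ContinuousLinearMap.adjoint_inner_right, hT i, hT j,
    inner_smul_left, inner_smul_right, orthonormal_iff_ite.mp he]
  split_ifs with h
  · subst h; simp
  · simp

theorem nonneg (he : Orthonormal ℂ e)
    (ht : (Submodule.span ℂ (Set.range e)).topologicalClosure = ⊤)
    (hT : IsDiagonalOn e T a) (ha : ∀ i, 0 ≤ a i) : 0 ≤ T := by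
  have hstar := hT.isSelfAdjoint he ht
  rw [ContinuousLinearMap.nonneg_iff_isPositive, ContinuousLinearMap.isPositive_def']
  refine ⟨hstar, fun x => ?_⟩
  let b : HilbertBasis ι ℂ K := HilbertBasis.mk he ht.ge
  have hb : ∀ i, b i = e i := fun i => by simp [b]
  have hs := (b.hasSum_inner_mul_inner (T x) x).mapL RCLike.reCLM
  rw [ContinuousLinearMap.reApplyInnerSelf_apply]
  refine hs.nonneg fun i => ?_
  rw [hb]
  have h1 : inner ℂ (T x) (e i) = (a i : ℂ) * inner ℂ x (e i) := by
    rw [← inner_smul_right, ← hT i, ← ContinuousLinearMap.adjoint_inner_right,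
      ← ContinuousLinearMap.star_eq_adjoint, hstar]
  rw [h1, mul_assoc, RCLike.reCLM_apply, ← Complex.real_smul, RCLike.smul_re, inner_mul_symm_re_eq_norm]
  exact mul_nonneg (ha i) (norm_nonneg _)

theorem sqrt (he : Orthonormal ℂ e)
    (ht : (Submodule.span ℂ (Set.range e)).topologicalClosure = ⊤)
    (hT : IsDiagonalOn e T a) (ha : ∀ i, 0 ≤ a i) :
    IsDiagonalOn e (CFC.sqrt T) fun i => √(a i) := by
  intro i
  have hTn := hT.nonneg he ht ha
  have hRR : CFC.sqrt T * CFC.sqrt T = T := CFC.sqrt_mul_sqrt_self T hTn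
  have hR := CFC.sqrt_nonneg T
  generalize CFC.sqrt T = R at hRR hR
  have hRp := ContinuousLinearMap.nonneg_iff_isPositive R |>.mp hR
  have hRRi : R (R (e i)) = (a i : ℂ) • e i := by
    rw [← hT i, ← hRR]; rfl
  obtain h0 | h0 := (ha i).eq_or_lt
  · have : inner ℂ (R (e i)) (R (e i)) = 0 := by
      have hsa := hRp.isSelfAdjoint
      rw [← ContinuousLinearMap.adjoint_inner_left, ← ContinuousLinearMap.star_eq_adjoint,
        hsa.star_eq, hRRi, ← h0]
      simp
    rw [inner_self_eq_zero] at this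
    simp [this, ← h0]
  · set c := √(a i) with hc
    have hc0 : 0 < c := Real.sqrt_pos.mpr h0
    have hcc : ((c : ℂ) * c) = a i := by
      rw [← Complex.ofReal_mul, Real.mul_self_sqrt (ha i)]
    set v := R (e i) - (c : ℂ) • e i with hv
    have hRv : R v = -((c : ℂ) • v) := by
      rw [hv, map_sub, map_smul, hRRi, ← hcc, smul_sub, mul_smul]
      abel
    have h2 := hRp.re_inner_nonneg_left v
    rw [hRv, inner_neg_left, inner_smul_left] at h2
    have h3 : c * ‖v‖ ^ 2 ≤ 0 := by
      rw [inner_self_eq_norm_sq_to_K] at h2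
      simp at h2
      norm_cast at h2
    have h4 : ‖v‖ = 0 := by
      by_contra h
      have : 0 < ‖v‖ ^ 2 := by positivity
      nlinarith
    exact sub_eq_zero.mp (norm_eq_zero.mp h4)

theorem isUnit (he : Orthonormal ℂ e)
    (ht : (Submodule.span ℂ (Set.range e)).topologicalClosure = ⊤)
    (hT : IsDiagonalOn e T a) {δ : ℝ} (hδ : 0 < δ) (ha : ∀ i, δ ≤ a i) : IsUnit T := by
  have h1 : (0 : K →L[ℂ] K) ≤ T - (δ : ℂ) • 1 :=
    (hT.sub (one.smul δ)).nonneg he ht fun i => by simpa using ha i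
  have h2 : (0 : K →L[ℂ] K) ≤ (δ : ℂ) • 1 :=
    (one.smul δ).nonneg he ht fun i => by simpa using hδ.le
  refine CStarAlgebra.isUnit_of_le ((δ : ℂ) • (1 : K →L[ℂ] K)) (sub_nonneg.mp h1) ?_
  refine IsUnit.isStrictlyPositive ?_ h2
  have hne : (δ : ℂ) ≠ 0 := by exact_mod_cast hδ.ne'
  simpa [Algebra.algebraMap_eq_smul_one] using hne.isUnit.map (algebraMap ℂ (K →L[ℂ] K))

theorem ringInverse (he : Orthonormal ℂ e)
    (ht : (Submodule.span ℂ (Set.range e)).topologicalClosure = ⊤)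
    (hT : IsDiagonalOn e T a) {δ : ℝ} (hδ : 0 < δ) (ha : ∀ i, δ ≤ a i) :
    IsDiagonalOn e (Ring.inverse T) fun i => (a i)⁻¹ := by
  intro i
  have h := Ring.inverse_mul_cancel T (hT.isUnit he ht hδ ha)
  have h1 : Ring.inverse T (T (e i)) = e i := by
    rw [← mul_apply_eq_comp, h, one_apply_eq_self]
  rw [hT i, map_smul] at h1
  have hne : (a i : ℂ) ≠ 0 := by exact_mod_cast (hδ.trans_le (ha i)).ne'
  conv_rhs => rw [← h1]
  rw [smul_smul, Complex.ofReal_inv, inv_mul_cancel₀ hne, one_smul]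

end IsDiagonalOn

end Total

section Shift

variable {κ K : Type*} [NormedAddCommGroup K] [InnerProductSpace ℂ K]
  {e : κ × ℕ → K} {V : K →L[ℂ] K}

theorem shift_pow_apply (hV : ∀ i m, V (e (i, m)) = e (i, m + 1)) (n : ℕ) (i : κ) (m : ℕ) :
    (V ^ n) (e (i, m)) = e (i, m + n) := by
  induction n generalizing m with
  | zero => simp
  | succ n ih =>
    rw [pow_succ, mul_apply_eq_comp, hV, ih, add_right_comm, add_assoc]

variable [CompleteSpace K]

theorem star_shift_pow_apply_add (he : Orthonormal ℂ e)
    (ht : (Submodule.span ℂ (Set.range e)).topologicalClosure = ⊤)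
    (hV : ∀ i m, V (e (i, m)) = e (i, m + 1)) (n : ℕ) (i : κ) (m : ℕ) :
    (star V ^ n) (e (i, m + n)) = e (i, m) := by
  classical
  refine eq_of_inner_total ht ?_
  rintro ⟨j, k⟩
  rw [← star_pow, ContinuousLinearMap.star_eq_adjoint, ContinuousLinearMap.adjoint_inner_right,
    shift_pow_apply hV, orthonormal_iff_ite.mp he, orthonormal_iff_ite.mp he]
  simp

theorem star_shift_pow_apply_of_lt (he : Orthonormal ℂ e)
    (ht : (Submodule.span ℂ (Set.range e)).topologicalClosure = ⊤)
    (hV : ∀ i m, V (e (i, m)) = e (i, m + 1)) {n m : ℕ} (i : κ) (hm : m < n) :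
    (star V ^ n) (e (i, m)) = 0 := by
  classical
  refine eq_of_inner_total ht ?_
  rintro ⟨j, k⟩
  rw [← star_pow, ContinuousLinearMap.star_eq_adjoint, ContinuousLinearMap.adjoint_inner_right,
    shift_pow_apply hV, orthonormal_iff_ite.mp he, inner_zero_right, if_neg]
  simp only [Prod.mk.injEq, not_and]
  omega

end Shift

/-- The eigenvalues of `ζ`. -/
noncomputable def zetaEigenvalue (q s : ℝ) : Bool × ℕ → ℝ
  | (false, m) => -(s ^ 2 * q ^ (2 * (m + 1)))
  | (true, m) => q ^ (2 * (m + 1))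

theorem zpow_mul_zetaEigenvalue {q : ℝ} (hq : 0 < q) (s : ℝ) (n k : ℕ) (i : Bool) (m : ℕ) :
    q ^ (2 * (k : ℤ) - 2 * (n : ℤ)) * zetaEigenvalue q s (i, m + n) =
      q ^ (2 * k) * zetaEigenvalue q s (i, m) := by
  have h : q ^ (2 * (k : ℤ) - 2 * (n : ℤ)) * q ^ (2 * (m + n + 1)) =
      q ^ (2 * k) * q ^ (2 * (m + 1)) := by
    rw [← zpow_natCast, ← zpow_natCast, ← zpow_natCast, ← zpow_add₀ hq.ne', ← zpow_add₀ hq.ne']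
    congr 1
    push_cast
    ring
  cases i
  · simp only [zetaEigenvalue]
    linear_combination -s ^ 2 * h
  · exact h

/-- The eigenvalues of `∏ k < n, (1 - c k • ζ)`. -/
noncomputable def prodOneSub (q s : ℝ) (n : ℕ) (c : ℕ → ℝ) (p : Bool × ℕ) : ℝ :=
  ∏ k ∈ Finset.range n, (1 - c k * zetaEigenvalue q s p)

/-- The eigenvalues of `∏ k < n, (s ^ 2 + c k • ζ)`. -/
noncomputable def prodSqAdd (q s : ℝ) (n : ℕ) (c : ℕ → ℝ) (p : Bool × ℕ) : ℝ :=
  ∏ k ∈ Finset.range n, (s ^ 2 + c k * zetaEigenvalue q s p)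

section Eigenvalues

variable {q s : ℝ} {n : ℕ} {c : ℕ → ℝ}

theorem one_le_prodOneSub_false (hq : 0 < q) (hc : ∀ k, 0 ≤ c k) (m : ℕ) :
    1 ≤ prodOneSub q s n c (false, m) := by
  rw [← Finset.prod_const_one (s := Finset.range n)]
  refine Finset.prod_le_prod (fun _ _ => zero_le_one) fun k _ => ?_
  have : 0 ≤ c k * (s ^ 2 * q ^ (2 * (m + 1))) := mul_nonneg (hc k) (by positivity)
  simp only [zetaEigenvalue]
  linarith

theorem pow_le_prodSqAdd_true (hq : 0 < q) (hc : ∀ k, 0 ≤ c k) (m : ℕ) :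
    (s ^ 2) ^ n ≤ prodSqAdd q s n c (true, m) := by
  have h : ∏ _k ∈ Finset.range n, s ^ 2 ≤ prodSqAdd q s n c (true, m) := by
    refine Finset.prod_le_prod (fun _ _ => by positivity) fun k _ => ?_
    have : 0 ≤ c k * q ^ (2 * (m + 1)) := mul_nonneg (hc k) (by positivity)
    simp only [zetaEigenvalue]
    linarith
  simpa using h

theorem prodSqAdd_false (m : ℕ) :
    prodSqAdd q s n c (false, m) = (s ^ 2) ^ n * prodOneSub q s n c (true, m) := by
  have : (s ^ 2) ^ n = ∏ _k ∈ Finset.range n, s ^ 2 := by simp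
  rw [this, prodSqAdd, prodOneSub, ← Finset.prod_mul_distrib]
  refine Finset.prod_congr rfl fun k _ => ?_
  simp only [zetaEigenvalue]
  ring

theorem prodOneSub_true_nonneg (hq : 0 < q) (hq1 : q < 1) (m : ℕ) :
    0 ≤ prodOneSub q s n (fun k => q ^ (2 * k)) (true, m) := by
  refine Finset.prod_nonneg fun k _ => ?_
  simp only [zetaEigenvalue, sub_nonneg, ← pow_add]
  exact pow_le_one₀ hq.le hq1.le

theorem prodOneSub_zpow_add (hq : 0 < q) (i : Bool) (m : ℕ) :
    prodOneSub q s n (fun k => q ^ (2 * (k : ℤ) - 2 * (n : ℤ))) (i, m + n) =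
      prodOneSub q s n (fun k => q ^ (2 * k)) (i, m) :=
  Finset.prod_congr rfl fun k _ => by rw [zpow_mul_zetaEigenvalue hq]

theorem prodSqAdd_zpow_add (hq : 0 < q) (i : Bool) (m : ℕ) :
    prodSqAdd q s n (fun k => q ^ (2 * (k : ℤ) - 2 * (n : ℤ))) (i, m + n) =
      prodSqAdd q s n (fun k => q ^ (2 * k)) (i, m) :=
  Finset.prod_congr rfl fun k _ => by rw [zpow_mul_zetaEigenvalue hq]

theorem prodOneSub_zpow_of_lt (hq : 0 < q) {m : ℕ} (hm : m < n) :
    prodOneSub q s n (fun k => q ^ (2 * (k : ℤ) - 2 * (n : ℤ))) (true, m) = 0 := by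
  refine Finset.prod_eq_zero (Finset.mem_range.mpr (show n - 1 - m < n by omega)) ?_
  simp only [zetaEigenvalue]
  rw [← zpow_natCast, ← zpow_add₀ hq.ne', show (2 * ((n - 1 - m : ℕ) : ℤ) - 2 * (n : ℤ) +
    ((2 * (m + 1) : ℕ) : ℤ)) = 0 by omega]
  simp

theorem prodOneSub_zpow_true_nonneg (hq : 0 < q) (hq1 : q < 1) (m : ℕ) :
    0 ≤ prodOneSub q s n (fun k => q ^ (2 * (k : ℤ) - 2 * (n : ℤ))) (true, m) := by
  obtain hm | hm := lt_or_ge m n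
  · exact (prodOneSub_zpow_of_lt hq hm).ge
  · obtain ⟨m, rfl⟩ := Nat.exists_eq_add_of_le' hm
    rw [prodOneSub_zpow_add hq]
    exact prodOneSub_true_nonneg hq hq1 m

theorem prodOneSub_nonneg (hq : 0 < q) (hc : ∀ k, 0 ≤ c k)
    (h : ∀ m, 0 ≤ prodOneSub q s n c (true, m)) (p : Bool × ℕ) : 0 ≤ prodOneSub q s n c p := by
  obtain ⟨_ | _, m⟩ := p
  · exact zero_le_one.trans (one_le_prodOneSub_false hq hc m)
  · exact h m

theorem prodSqAdd_nonneg (hq : 0 < q) (hc : ∀ k, 0 ≤ c k)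
    (h : ∀ m, 0 ≤ prodOneSub q s n c (true, m)) (p : Bool × ℕ) : 0 ≤ prodSqAdd q s n c p := by
  obtain ⟨_ | _, m⟩ := p
  · rw [prodSqAdd_false]
    exact mul_nonneg (by positivity) (h m)
  · exact (show 0 ≤ (s ^ 2) ^ n by positivity).trans (pow_le_prodSqAdd_true hq hc m)

theorem min_le_prodOneSub_add_prodSqAdd (hq : 0 < q) (hc : ∀ k, 0 ≤ c k)
    (h : ∀ m, 0 ≤ prodOneSub q s n c (true, m)) (p : Bool × ℕ) :
    min 1 ((s ^ 2) ^ n) ≤ prodOneSub q s n c p + prodSqAdd q s n c p := by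
  have h1 := prodOneSub_nonneg hq hc h p
  have h2 := prodSqAdd_nonneg hq hc h p
  obtain ⟨_ | _, m⟩ := p
  · have := one_le_prodOneSub_false (s := s) (n := n) hq hc m
    exact (min_le_left _ _).trans (by linarith)
  · have := pow_le_prodSqAdd_true (s := s) (n := n) hq hc m
    exact (min_le_right _ _).trans (by linarith)

end Eigenvalues

theorem sqrt_div_mul_sqrt_div {x y : ℝ} (hx : 0 ≤ x) (hy : 0 ≤ y) :
    √(y * (x + y)⁻¹) * √(x * (x + y)⁻¹) = √(x * y) * (x + y)⁻¹ := by
  have hxy : 0 ≤ (x + y)⁻¹ := by positivity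
  rw [← Real.sqrt_mul (by positivity), show y * (x + y)⁻¹ * (x * (x + y)⁻¹) =
    x * y * ((x + y)⁻¹ * (x + y)⁻¹) by ring, Real.sqrt_mul (by positivity),
    Real.sqrt_mul_self hxy]

/-- On `K ≅ H ⊕ H` (total orthonormal family `e : Bool × ℕ → K`, minus copy `false`,
plus copy `true`), with `ζ = Z₋ ⊕ Z₊`, `𝔖 = S ⊕ S`, the commuting positive operators
`f_n(ζ), g_n(ζ), F_n, G_n` given by the indicated products, square roots via the continuous
functional calculus and inverses via `Ring.inverse`:  the row vector
`Y_n = ( √(G_n(F_n+G_n)⁻¹) , √(F_n(F_n+G_n)⁻¹)·𝔖ⁿ )` satisfies `Y_n Y_n* = E_n = SⁿS*ⁿ ⊕ 1`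
(the operator acting as `SⁿS*ⁿ` on the first copy and as `1` on the second copy) and
`Y_n* Y_n = Q_n`; in particular the projections `E_n` and `Q_n` are Murray–von Neumann
equivalent. -/
theorem stmt2
    (q s : ℝ) (hq0 : 0 < q) (hq1 : q < 1) (hs : 0 < s)
    {K : Type*} [NormedAddCommGroup K] [InnerProductSpace ℂ K] [CompleteSpace K]
    (e : Bool × ℕ → K) (he : Orthonormal ℂ e)
    (htotal : (Submodule.span ℂ (Set.range e)).topologicalClosure = ⊤)
    (ζ 𝔖 : K →L[ℂ] K)
    (hζm : ∀ m : ℕ, ζ (e (false, m)) = ((-(s ^ 2 * q ^ (2 * (m + 1))) : ℝ) : ℂ) • e (false, m))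
    (hζp : ∀ m : ℕ, ζ (e (true, m)) = ((q ^ (2 * (m + 1)) : ℝ) : ℂ) • e (true, m))
    (h𝔖 : ∀ (i : Bool) (m : ℕ), 𝔖 (e (i, m)) = e (i, m + 1))
    (n : ℕ) (hn : 1 ≤ n)
    (fn gn Fn Gn : K →L[ℂ] K)
    (hfn : fn = ((List.range n).map fun k => 1 - ((q ^ (2 * k) : ℝ) : ℂ) • ζ).prod)
    (hgn : gn = ((List.range n).map fun k => ((s ^ 2 : ℝ) : ℂ) • (1 : K →L[ℂ] K) + ((q ^ (2 * k) : ℝ) : ℂ) • ζ).prod)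
    (hFn : Fn = ((List.range n).map fun k => 1 - ((q ^ (2 * (k : ℤ) - 2 * (n : ℤ)) : ℝ) : ℂ) • ζ).prod)
    (hGn : Gn = ((List.range n).map fun k => ((s ^ 2 : ℝ) : ℂ) • (1 : K →L[ℂ] K) + ((q ^ (2 * (k : ℤ) - 2 * (n : ℤ)) : ℝ) : ℂ) • ζ).prod)
    (En : K →L[ℂ] K)
    (hEm : ∀ m : ℕ, En (e (false, m)) = if m < n then 0 else e (false, m))
    (hEp : ∀ m : ℕ, En (e (true, m)) = e (true, m))
    (Q : Matrix (Fin 2) (Fin 2) (K →L[ℂ] K))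
    (hQ : Q = !![Gn * Ring.inverse (Fn + Gn),
                 CFC.sqrt (Fn * Gn) * Ring.inverse (Fn + Gn) * 𝔖 ^ n;
                 CFC.sqrt (fn * gn) * Ring.inverse (fn + gn) * (star 𝔖) ^ n,
                 fn * Ring.inverse (fn + gn)])
    (Y : Matrix (Fin 1) (Fin 2) (K →L[ℂ] K))
    (hY : Y = !![CFC.sqrt (Gn * Ring.inverse (Fn + Gn)),
                 CFC.sqrt (Fn * Ring.inverse (Fn + Gn)) * 𝔖 ^ n]) :
    Y * Y.conjTranspose = !![En] ∧ Y.conjTranspose * Y = Q := by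
  have hζ : IsDiagonalOn e ζ (zetaEigenvalue q s) := by
    rintro ⟨_ | _, m⟩
    · exact hζm m
    · exact hζp m
  set c : ℕ → ℝ := fun k => q ^ (2 * k)
  set C : ℕ → ℝ := fun k => q ^ (2 * (k : ℤ) - 2 * (n : ℤ))
  have hc : ∀ k : ℕ, 0 ≤ c k := fun k => by positivity
  have hC : ∀ k : ℕ, 0 ≤ C k := fun k => by positivity
  have hsub (c : ℕ → ℝ) := IsDiagonalOn.list_prod_range
    (fun k => IsDiagonalOn.one.sub (hζ.smul (c k))) n
  have hadd (c : ℕ → ℝ) := IsDiagonalOn.list_prod_range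
    (fun k => ((IsDiagonalOn.one (e := e)).smul (s ^ 2)).add (hζ.smul (c k))) n
  simp only [mul_one] at hadd
  have df : IsDiagonalOn e fn (prodOneSub q s n c) := hfn ▸ hsub c
  have dF : IsDiagonalOn e Fn (prodOneSub q s n C) := by
    rw [hFn]
    simp only [List.bind_eq_flatMap, List.pure_def, ← List.map_eq_flatMap, List.map_map]
    exact hsub C
  have dg : IsDiagonalOn e gn (prodSqAdd q s n c) := hgn ▸ hadd c
  have dG : IsDiagonalOn e Gn (prodSqAdd q s n C) := by
    rw [hGn]
    simp only [List.bind_eq_flatMap, List.pure_def, ← List.map_eq_flatMap, List.map_map]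
    exact hadd C
  have tc : ∀ m, 0 ≤ prodOneSub q s n c (true, m) :=
    prodOneSub_true_nonneg (s := s) (n := n) hq0 hq1
  have tC : ∀ m, 0 ≤ prodOneSub q s n C (true, m) :=
    prodOneSub_zpow_true_nonneg (s := s) (n := n) hq0 hq1
  have pf := prodOneSub_nonneg hq0 hc tc
  have pg := prodSqAdd_nonneg hq0 hc tc
  have pF := prodOneSub_nonneg hq0 hC tC
  have pG := prodSqAdd_nonneg hq0 hC tC
  have lc := min_le_prodOneSub_add_prodSqAdd hq0 hc tc
  have lC := min_le_prodOneSub_add_prodSqAdd hq0 hC tC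
  have hδ : 0 < min 1 ((s ^ 2) ^ n) := lt_min one_pos (by positivity)
  have sF (i : Bool) (m : ℕ) : prodOneSub q s n C (i, m + n) = prodOneSub q s n c (i, m) :=
    prodOneSub_zpow_add hq0 i m
  have sG (i : Bool) (m : ℕ) : prodSqAdd q s n C (i, m + n) = prodSqAdd q s n c (i, m) :=
    prodSqAdd_zpow_add hq0 i m
  have zF {m : ℕ} (hm : m < n) : prodOneSub q s n C (true, m) = 0 :=
    prodOneSub_zpow_of_lt hq0 hm
  have zG {m : ℕ} (hm : m < n) : prodSqAdd q s n C (false, m) = 0 := by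
    rw [prodSqAdd_false, zF hm, mul_zero]
  have hpow := shift_pow_apply h𝔖 n
  have hstar := star_shift_pow_apply_add he htotal h𝔖 n
  have hstar0 := fun i m (hm : m < n) => star_shift_pow_apply_of_lt he htotal h𝔖 i hm
  clear_value c C
  generalize prodOneSub q s n c = f, prodSqAdd q s n c = g, prodOneSub q s n C = F,
    prodSqAdd q s n C = G at *
  have hpos := fun p => hδ.trans_le (lC p)
  have dinv := (dF.add dG).ringInverse he htotal hδ lC
  have dinv' := (df.add dg).ringInverse he htotal hδ lc
  have dA := dG.mul dinv
  have dB := dF.mul dinv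
  have pA : ∀ p, 0 ≤ G p * (F p + G p)⁻¹ := fun p => mul_nonneg (pG p) (inv_pos.mpr (hpos p)).le
  have pB : ∀ p, 0 ≤ F p * (F p + G p)⁻¹ := fun p => mul_nonneg (pF p) (inv_pos.mpr (hpos p)).le
  have dsA := dA.sqrt he htotal pA
  have dsB := dB.sqrt he htotal pB
  have dFG := ((dF.mul dG).sqrt he htotal fun p => mul_nonneg (pF p) (pG p)).mul dinv
  have dfg := ((df.mul dg).sqrt he htotal fun p => mul_nonneg (pf p) (pg p)).mul dinv'
  have dq := df.mul dinv'
  have hsA := dsA.isSelfAdjoint he htotal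
  have hsB := dsB.isSelfAdjoint he htotal
  have dAA : CFC.sqrt (Gn * Ring.inverse (Fn + Gn)) * CFC.sqrt (Gn * Ring.inverse (Fn + Gn)) =
      Gn * Ring.inverse (Fn + Gn) := CFC.sqrt_mul_sqrt_self _ (dA.nonneg he htotal pA)
  have dBB : CFC.sqrt (Fn * Ring.inverse (Fn + Gn)) * CFC.sqrt (Fn * Ring.inverse (Fn + Gn)) =
      Fn * Ring.inverse (Fn + Gn) := CFC.sqrt_mul_sqrt_self _ (dB.nonneg he htotal pB)
  have dAB : CFC.sqrt (Gn * Ring.inverse (Fn + Gn)) * CFC.sqrt (Fn * Ring.inverse (Fn + Gn)) =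
      CFC.sqrt (Fn * Gn) * Ring.inverse (Fn + Gn) := by
    refine (dsA.mul dsB).eq htotal fun p => ?_
    rw [dFG p, sqrt_div_mul_sqrt_div (pF p) (pG p)]
  have dBA : CFC.sqrt (Fn * Ring.inverse (Fn + Gn)) * CFC.sqrt (Gn * Ring.inverse (Fn + Gn)) =
      CFC.sqrt (Fn * Gn) * Ring.inverse (Fn + Gn) := by
    refine (dsB.mul dsA).eq htotal fun p => ?_
    simp only [dFG p, ← sqrt_div_mul_sqrt_div (pF p) (pG p), mul_comm]
  generalize CFC.sqrt (Gn * Ring.inverse (Fn + Gn)) = A,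
    CFC.sqrt (Fn * Ring.inverse (Fn + Gn)) = B at *
  have e11 : A * A + B * 𝔖 ^ n * (star 𝔖 ^ n * B) = En := by
    have hsum (i : Bool) (m : ℕ) : (A * A + B * 𝔖 ^ n * (star 𝔖 ^ n * B)) (e (i, m + n)) =
        e (i, m + n) := by
      have h1 : √(F (i, m + n) * (F (i, m + n) + G (i, m + n))⁻¹) *
          √(F (i, m + n) * (F (i, m + n) + G (i, m + n))⁻¹) =
          F (i, m + n) * (F (i, m + n) + G (i, m + n))⁻¹ := Real.mul_self_sqrt (pB _)
      rw [dAA, add_apply, dA]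
      simp only [mul_apply_eq_comp, dsB (i, m + n), map_smul, hstar, hpow, smul_smul]
      rw [← Complex.ofReal_mul, h1, ← add_smul, ← Complex.ofReal_add, ← add_mul,
        add_comm (G _), mul_inv_cancel₀ (hpos _).ne', Complex.ofReal_one, one_smul]
    have hlow (i : Bool) {m : ℕ} (hm : m < n) :
        (A * A + B * 𝔖 ^ n * (star 𝔖 ^ n * B)) (e (i, m)) =
          ((G (i, m) * (F (i, m) + G (i, m))⁻¹ : ℝ) : ℂ) • e (i, m) := by
      rw [dAA, add_apply, dA]
      simp only [mul_apply_eq_comp, dsB (i, m), map_smul, hstar0 i m hm, map_zero,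
        smul_zero, add_zero]
    refine ext_of_total htotal ?_
    rintro ⟨i, m⟩
    obtain hm | hm := lt_or_ge m n
    · rw [hlow i hm]
      cases i
      · rw [hEm, if_pos hm, zG hm]; simp
      · have h1 := (hpos (true, m)).ne'
        rw [hEp, zF hm, zero_add, mul_inv_cancel₀ (by simpa [zF hm] using h1)]; simp
    · obtain ⟨m, rfl⟩ := Nat.exists_eq_add_of_le' hm
      rw [hsum]
      cases i
      · rw [hEm, if_neg (by omega)]
      · rw [hEp]
  have e21 : star 𝔖 ^ n * (CFC.sqrt (Fn * Gn) * Ring.inverse (Fn + Gn)) =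
      CFC.sqrt (fn * gn) * Ring.inverse (fn + gn) * star 𝔖 ^ n := by
    refine ext_of_total htotal ?_
    rintro ⟨i, m⟩
    rw [mul_apply_eq_comp, mul_apply_eq_comp _ (star 𝔖 ^ n), dFG, map_smul]
    obtain hm | hm := lt_or_ge m n
    · rw [hstar0 i m hm, map_zero, smul_zero]
    · obtain ⟨m, rfl⟩ := Nat.exists_eq_add_of_le' hm
      simp only [hstar, dfg (i, m), sF, sG]
  have e22 : star 𝔖 ^ n * (Fn * Ring.inverse (Fn + Gn)) * 𝔖 ^ n = fn * Ring.inverse (fn + gn) := by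
    refine ext_of_total htotal ?_
    rintro ⟨i, m⟩
    rw [mul_apply_eq_comp, mul_apply_eq_comp, hpow, dB, map_smul, hstar, dq]
    simp only [sF, sG]
  have hYs : Y.conjTranspose = !![A; star 𝔖 ^ n * B] := by
    rw [hY]
    ext1 i j
    fin_cases i <;> fin_cases j <;> simp [Matrix.conjTranspose_apply, hsA, hsB]
  refine ⟨?_, ?_⟩
  · rw [hYs, hY, ← e11]
    ext1 i j
    fin_cases i; fin_cases j
    simp [Matrix.mul_apply, Fin.sum_univ_two]
  · rw [hYs, hY, hQ, ← e21, ← e22, ← dBB, ← dAB]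
    ext1 i j
    fin_cases i <;> fin_cases j <;>
      simp [Matrix.mul_apply, mul_assoc, dAA, dBA.trans dAB.symm]
end

section
/- For every integer n ≥ 1, the 2×2 operator matrix Q_{−n} with entries (Q_{−n})₁₁ = F_n(F_n+G_n)⁻¹, (Q_{−n})₁₂ = −√(F_nG_n)(F_n+G_n)⁻¹𝔖ⁿ, (Q_{−n})₂₁ = −√(f_n(ζ)g_n(ζ))(f_n(ζ)+g_n(ζ))⁻¹𝔖*ⁿ, (Q_{−n})₂₂ = g_n(ζ)(f_n(ζ)+g_n(ζ))⁻¹ is a self-adjoint idempotent in the algebra of 2×2 matrices over B(H ⊕ H): Q_{−n}* = Q_{−n} and Q_{−n}² = Q_{−n}. -/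
set_option synthInstance.maxHeartbeats 1000000
set_option maxHeartbeats 1000000

open scoped InnerProductSpace

/-- `T` is diagonal in the Hilbert basis `b`, with real eigenvalues `d`. -/
def IsRealDiagonal {ι K : Type*} [NormedAddCommGroup K] [InnerProductSpace ℂ K]
    (b : HilbertBasis ι ℂ K) (T : K →L[ℂ] K) (d : ι → ℝ) : Prop :=
  ∀ i, T (b i) = (d i : ℂ) • b i

theorem HilbertBasis.clm_ext {ι K : Type*} [NormedAddCommGroup K] [InnerProductSpace ℂ K]
    (b : HilbertBasis ι ℂ K) {T U : K →L[ℂ] K} (h : ∀ i, T (b i) = U (b i)) : T = U :=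
  ContinuousLinearMap.ext_on (Submodule.dense_iff_topologicalClosure_eq_top.2 b.dense_span)
    (by rintro _ ⟨i, rfl⟩; exact h i)

theorem HilbertBasis.ext_inner {ι K : Type*} [NormedAddCommGroup K] [InnerProductSpace ℂ K]
    (b : HilbertBasis ι ℂ K) {x y : K} (h : ∀ i, ⟪b i, x⟫_ℂ = ⟪b i, y⟫_ℂ) : x = y := by
  apply b.repr.injective
  ext i
  simpa [b.repr_apply_apply] using h i

namespace IsRealDiagonal

variable {ι K : Type*} [NormedAddCommGroup K] [InnerProductSpace ℂ K]
  {b : HilbertBasis ι ℂ K} {T U : K →L[ℂ] K} {d d' : ι → ℝ}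

theorem eq_of_eigenvalues_eq (hT : IsRealDiagonal b T d) (hU : IsRealDiagonal b U d')
    (h : ∀ i, d i = d' i) : T = U :=
  b.clm_ext fun i => by rw [hT i, hU i, h i]

theorem congr (hT : IsRealDiagonal b T d) (h : ∀ i, d i = d' i) : IsRealDiagonal b T d' :=
  fun i => by rw [hT i, h i]

theorem add (hT : IsRealDiagonal b T d) (hU : IsRealDiagonal b U d') :
    IsRealDiagonal b (T + U) (fun i => d i + d' i) := fun i => by
  simp [hT i, hU i, add_smul]

theorem sub (hT : IsRealDiagonal b T d) (hU : IsRealDiagonal b U d') :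
    IsRealDiagonal b (T - U) (fun i => d i - d' i) := fun i => by
  simp [hT i, hU i, sub_smul]

theorem mul (hT : IsRealDiagonal b T d) (hU : IsRealDiagonal b U d') :
    IsRealDiagonal b (T * U) (fun i => d i * d' i) := fun i => by
  simp only [mul_apply_eq_comp, hU i, map_smul, hT i, smul_smul, Complex.ofReal_mul, mul_comm]

theorem smul (r : ℝ) (hT : IsRealDiagonal b T d) :
    IsRealDiagonal b ((r : ℂ) • T) (fun i => r * d i) := fun i => by
  simp only [smul_apply, hT i, smul_smul, Complex.ofReal_mul]

theorem one : IsRealDiagonal b 1 (fun _ => 1) := fun i => by simp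

theorem list_prod {f : ℕ → K →L[ℂ] K} {d : ℕ → ι → ℝ}
    (h : ∀ k, IsRealDiagonal b (f k) (d k)) (n : ℕ) :
    IsRealDiagonal b ((List.range n).map f).prod (fun i => ∏ k ∈ Finset.range n, d k i) := by
  induction n with
  | zero => simpa using one
  | succ n ih =>
    simp only [List.range_succ, List.map_append, List.prod_append, List.map_singleton,
      List.prod_singleton, Finset.prod_range_succ]
    exact ih.mul (h n)

variable [CompleteSpace K]

theorem star_eq (hT : IsRealDiagonal b T d) : star T = T := by
  refine b.clm_ext fun i => b.ext_inner fun j => ?_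
  rw [ContinuousLinearMap.star_eq_adjoint, ContinuousLinearMap.adjoint_inner_right, hT, hT,
    inner_smul_left, inner_smul_right]
  classical
  rw [orthonormal_iff_ite.1 b.orthonormal j i]
  split_ifs with h <;> simp [h]

open scoped ComplexOrder in
theorem nonneg (hT : IsRealDiagonal b T d) (hd : ∀ i, 0 ≤ d i) : 0 ≤ T := by
  rw [ContinuousLinearMap.nonneg_iff_isPositive, ContinuousLinearMap.isPositive_iff']
  refine ⟨hT.star_eq, fun x => ?_⟩
  refine (b.hasSum_inner_mul_inner (T x) x).nonneg fun i => ?_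
  have h : ⟪T x, b i⟫_ℂ = (d i : ℂ) * ⟪x, b i⟫_ℂ := by
    rw [← ContinuousLinearMap.adjoint_inner_right, ← ContinuousLinearMap.star_eq_adjoint,
      hT.star_eq, hT, inner_smul_right]
  rw [h, mul_assoc, ← inner_conj_symm (b i) x, Complex.mul_conj, ← Complex.ofReal_mul]
  exact_mod_cast mul_nonneg (hd i) (Complex.normSq_nonneg _)

theorem isUnit (hT : IsRealDiagonal b T d) {c : ℝ} (hc : 0 < c) (hd : ∀ i, c ≤ d i) :
    IsUnit T := by
  have h : 0 ≤ T - (c : ℂ) • 1 := (hT.sub (one.smul c)).nonneg fun i => by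
    simpa using hd i
  refine CStarAlgebra.isUnit_of_le ((c : ℂ) • (1 : K →L[ℂ] K)) (sub_nonneg.1 h) ?_
  refine IsUnit.isStrictlyPositive ?_ ((one (b := b).smul c).nonneg fun i => by simpa using hc.le)
  exact isUnit_one.smul (Units.mk0 (c : ℂ) (by exact_mod_cast hc.ne'))

theorem inverse (hT : IsRealDiagonal b T d) {c : ℝ} (hc : 0 < c) (hd : ∀ i, c ≤ d i) :
    IsRealDiagonal b (Ring.inverse T) (fun i => (d i)⁻¹) := fun i => by
  have h0 : (d i : ℂ) ≠ 0 := by exact_mod_cast (hc.trans_le (hd i)).ne'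
  have h := congrArg (fun S : K →L[ℂ] K => S (b i)) (Ring.inverse_mul_cancel T (hT.isUnit hc hd))
  simp only [mul_apply_eq_comp, hT i, map_smul, one_apply_eq_self] at h
  rw [Complex.ofReal_inv, eq_inv_smul_iff₀ h0, h]

theorem sqrt (hT : IsRealDiagonal b T d) (hd : ∀ i, 0 ≤ d i) :
    IsRealDiagonal b (CFC.sqrt T) (fun i => √(d i)) := fun i => by
  beta_reduce
  set R := CFC.sqrt T with hR
  have hRR : R * R = T := CFC.sqrt_mul_sqrt_self T (hT.nonneg hd)
  have hRpos : R.IsPositive :=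
    (ContinuousLinearMap.nonneg_iff_isPositive _).1 (CFC.sqrt_nonneg T)
  have hRRi : R (R (b i)) = (d i : ℂ) • b i := by rw [← hT i, ← hRR]; rfl
  have hsq : ((√(d i) : ℝ) : ℂ) * (√(d i) : ℝ) = d i := by
    exact_mod_cast Real.mul_self_sqrt (hd i)
  rcases (Real.sqrt_nonneg (d i)).eq_or_lt with h0 | h0
  · have hd0 : (d i : ℂ) = 0 := by rw [← hsq, ← h0]; simp
    rw [← h0, Complex.ofReal_zero, zero_smul, ← inner_self_eq_zero (𝕜 := ℂ),
      hRpos.inner_left_eq_inner_right, hRRi, hd0]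
    simp
  · set v := R (b i) - ((√(d i) : ℝ) : ℂ) • b i with hv
    have hRv : R v = -(((√(d i) : ℝ) : ℂ) • v) := by
      rw [hv, map_sub, map_smul, hRRi, ← hsq, smul_sub, smul_smul]
      abel
    have h1 := hRpos.re_inner_nonneg_left v
    rw [hRv, ← neg_smul, inner_smul_left, inner_self_eq_norm_sq_to_K] at h1
    have h2 : 0 ≤ -(√(d i) * ‖v‖ ^ 2) := by
      simpa [← Complex.ofReal_pow, ← Complex.ofReal_mul] using h1
    have h3 : ‖v‖ ^ 2 = 0 := by
      nlinarith [mul_nonneg h0.le (sq_nonneg ‖v‖), mul_pos h0 h0, sq_nonneg ‖v‖]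
    exact sub_eq_zero.1 (norm_eq_zero.1 (pow_eq_zero_iff two_ne_zero |>.1 h3))

end IsRealDiagonal

section Shift

variable {K : Type*} [NormedAddCommGroup K] [InnerProductSpace ℂ K]
  {b : HilbertBasis (Bool × ℕ) ℂ K} {S : K →L[ℂ] K}

theorem shift_pow_apply_s5 (hS : ∀ i m, S (b (i, m)) = b (i, m + 1)) (n : ℕ) (i : Bool) (m : ℕ) :
    (S ^ n) (b (i, m)) = b (i, m + n) := by
  induction n with
  | zero => simp
  | succ n ih => rw [pow_succ', mul_apply_eq_comp, ih, hS, add_assoc]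

theorem IsRealDiagonal.mul_shift_pow {C D : K →L[ℂ] K} {c d : Bool × ℕ → ℝ}
    (hS : ∀ i m, S (b (i, m)) = b (i, m + 1)) (n : ℕ)
    (hC : IsRealDiagonal b C c) (hD : IsRealDiagonal b D d)
    (hcd : ∀ i m, c (i, m + n) = d (i, m)) : C * S ^ n = S ^ n * D :=
  b.clm_ext fun ⟨i, m⟩ => by
    simp only [mul_apply_eq_comp, shift_pow_apply_s5 hS, hC _, hD _, map_smul, hcd]

variable [CompleteSpace K]

theorem star_shift_pow_mul (hS : ∀ i m, S (b (i, m)) = b (i, m + 1)) (n : ℕ) :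
    star S ^ n * S ^ n = 1 := by
  rw [← star_pow]
  refine b.clm_ext fun ⟨i, m⟩ => b.ext_inner fun ⟨j, k⟩ => ?_
  rw [mul_apply_eq_comp, ContinuousLinearMap.star_eq_adjoint,
    ContinuousLinearMap.adjoint_inner_right, shift_pow_apply_s5 hS, shift_pow_apply_s5 hS,
    one_apply_eq_self, orthonormal_iff_ite.1 b.orthonormal, orthonormal_iff_ite.1 b.orthonormal]
  simp

theorem IsRealDiagonal.shift_pow_mul_star_mul {C : K →L[ℂ] K} {c : Bool × ℕ → ℝ}
    (hS : ∀ i m, S (b (i, m)) = b (i, m + 1)) (n : ℕ) (hC : IsRealDiagonal b C c)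
    (hc : ∀ i, ∀ m < n, c (i, m) = 0) : S ^ n * star S ^ n * C = C :=
  b.clm_ext fun ⟨i, m⟩ => by
    rw [mul_apply_eq_comp, hC (i, m)]
    rcases lt_or_ge m n with h | h
    · simp [hc i m h]
    · obtain ⟨k, rfl⟩ := Nat.exists_eq_add_of_le' h
      rw [map_smul, ← shift_pow_apply_s5 hS n i k, ← mul_apply_eq_comp, mul_assoc,
        star_shift_pow_mul hS, mul_one]

theorem IsRealDiagonal.isStarProjection_matrix {A B C D : K →L[ℂ] K} {α β c d : Bool × ℕ → ℝ}
    (hS : ∀ i m, S (b (i, m)) = b (i, m + 1)) (n : ℕ)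
    (hA : IsRealDiagonal b A α) (hB : IsRealDiagonal b B β)
    (hC : IsRealDiagonal b C c) (hD : IsRealDiagonal b D d)
    (hcd : ∀ i m, c (i, m + n) = d (i, m)) (hc : ∀ i, ∀ m < n, c (i, m) = 0)
    (hα : ∀ i, α i * α i + c i * c i = α i) (hβ : ∀ i, d i * d i + β i * β i = β i)
    (hαβ : ∀ i m, α (i, m + n) + β (i, m) = 1)
    {Q : Matrix (Fin 2) (Fin 2) (K →L[ℂ] K)}
    (hQ : Q = !![A, -(C * S ^ n); -(D * star S ^ n), B]) : IsStarProjection Q := by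
  have hCS := hC.mul_shift_pow hS n hD hcd
  have hSC : star S ^ n * C = D * star S ^ n := by
    simpa [hC.star_eq, hD.star_eq] using congrArg star hCS
  have hP := hC.shift_pow_mul_star_mul hS n hc
  have hSS := star_shift_pow_mul hS n
  have hAA : A * A + C * C = A := ((hA.mul hA).add (hC.mul hC)).eq_of_eigenvalues_eq hA hα
  have hBB : D * D + B * B = B := ((hD.mul hD).add (hB.mul hB)).eq_of_eigenvalues_eq hB hβ
  have hAS : A * S ^ n = S ^ n * (1 - B) :=
    hA.mul_shift_pow hS n (one.sub hB) fun i m => by linarith [hαβ i m]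
  have hSA : star S ^ n * A = (1 - B) * star S ^ n := by
    simpa [hA.star_eq, hB.star_eq] using congrArg star hAS
  have hBD : B * D = D * B := (hB.mul hD).eq_of_eigenvalues_eq (hD.mul hB) fun _ => mul_comm _ _
  have hAC : A * C = C * A := (hA.mul hC).eq_of_eigenvalues_eq (hC.mul hA) fun _ => mul_comm _ _
  have h11 : C * S ^ n * (D * star S ^ n) = C * C := by
    rw [← hSC, mul_assoc, ← mul_assoc (S ^ n), hP]
  have h22 : D * star S ^ n * (C * S ^ n) = D * D := by
    rw [hCS, mul_assoc, ← mul_assoc (star S ^ n), hSS, one_mul]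
  have h12 : A * (C * S ^ n) + C * S ^ n * B = C * S ^ n := by
    rw [← mul_assoc, hAC, mul_assoc, hAS]
    noncomm_ring
  have h21 : D * star S ^ n * A + B * (D * star S ^ n) = D * star S ^ n := by
    rw [mul_assoc, hSA, ← mul_assoc B, hBD]
    noncomm_ring
  subst hQ
  refine ⟨?_, ?_⟩
  · rw [IsIdempotentElem, Matrix.mul_fin_two]
    simp only [neg_mul, mul_neg, neg_neg, h11, h22, hAA, hBB, ← neg_add, h12, h21]
  · rw [isSelfAdjoint_iff, Matrix.star_eq_conjTranspose]
    ext1 i j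
    fin_cases i <;> fin_cases j <;> simp [hA.star_eq, hB.star_eq, hD.star_eq, hCS]

end Shift

/-- The eigenvalues of `ζ`. -/
noncomputable def podlesEigenvalue (q s : ℝ) : Bool × ℕ → ℝ
  | (false, m) => -(s ^ 2 * q ^ (2 * (m + 1)))
  | (true, m) => q ^ (2 * (m + 1))

theorem zpow_mul_podlesEigenvalue_add {q : ℝ} (hq : q ≠ 0) (s : ℝ) (n k : ℕ) (i : Bool) (m : ℕ) :
    q ^ (2 * (k : ℤ) - 2 * (n : ℤ)) * podlesEigenvalue q s (i, m + n) =
      q ^ (2 * k) * podlesEigenvalue q s (i, m) := by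
  have h : q ^ (2 * (k : ℤ) - 2 * (n : ℤ)) * q ^ (2 * (m + n + 1)) =
      q ^ (2 * k) * q ^ (2 * (m + 1)) := by
    simp only [← zpow_natCast, ← zpow_add₀ hq]
    congr 1
    push_cast
    ring
  cases i
  · simp only [podlesEigenvalue]
    linear_combination -s ^ 2 * h
  · exact h

theorem prod_one_sub_zpow_eq_zero {q : ℝ} (hq : q ≠ 0) {n m : ℕ} (h : m < n) :
    ∏ k ∈ Finset.range n, (1 - q ^ (2 * (k : ℤ) - 2 * (n : ℤ)) * q ^ (2 * (m + 1))) = 0 := by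
  refine Finset.prod_eq_zero (i := n - 1 - m) (Finset.mem_range.2 (by omega)) ?_
  rw [← zpow_natCast, ← zpow_add₀ hq, sub_eq_zero, eq_comm]
  convert zpow_zero q using 2
  omega

theorem prod_one_sub_zpow_nonneg {q : ℝ} (hq0 : 0 < q) (hq1 : q < 1) (n m : ℕ) :
    0 ≤ ∏ k ∈ Finset.range n, (1 - q ^ (2 * (k : ℤ) - 2 * (n : ℤ)) * q ^ (2 * (m + 1))) := by
  rcases lt_or_ge m n with h | h
  · exact (prod_one_sub_zpow_eq_zero hq0.ne' h).ge
  · refine Finset.prod_nonneg fun k _ => ?_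
    rw [← zpow_natCast, ← zpow_add₀ hq0.ne', sub_nonneg]
    exact zpow_le_one₀ hq0 hq1.le (by omega)

section Eigenvalues

variable {q s : ℝ} (hq0 : 0 < q) (hq1 : q < 1) (n : ℕ)

/-- The eigenvalues of `F_n`. -/
noncomputable def eigenvalueF (q s : ℝ) (n : ℕ) (i : Bool × ℕ) : ℝ :=
  ∏ k ∈ Finset.range n, (1 - q ^ (2 * (k : ℤ) - 2 * (n : ℤ)) * podlesEigenvalue q s i)

/-- The eigenvalues of `G_n`. -/
noncomputable def eigenvalueG (q s : ℝ) (n : ℕ) (i : Bool × ℕ) : ℝ :=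
  ∏ k ∈ Finset.range n, (s ^ 2 + q ^ (2 * (k : ℤ) - 2 * (n : ℤ)) * podlesEigenvalue q s i)

theorem eigenvalueG_false (m : ℕ) : eigenvalueG q s n (false, m) = (s ^ 2) ^ n *
    ∏ k ∈ Finset.range n, (1 - q ^ (2 * (k : ℤ) - 2 * (n : ℤ)) * q ^ (2 * (m + 1))) := by
  conv_rhs => rw [← Finset.card_range n, ← Finset.prod_const, Finset.card_range,
    ← Finset.prod_mul_distrib]
  refine Finset.prod_congr rfl fun k _ => ?_
  simp only [podlesEigenvalue]
  ring

include hq0 in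
theorem one_le_eigenvalueF_false (m : ℕ) : 1 ≤ eigenvalueF q s n (false, m) := by
  refine Finset.one_le_prod fun k _ => ?_
  simp only [podlesEigenvalue]
  have : 0 ≤ q ^ (2 * (k : ℤ) - 2 * (n : ℤ)) * (s ^ 2 * q ^ (2 * (m + 1))) := by positivity
  linarith

include hq0 in
theorem pow_le_eigenvalueG_true (m : ℕ) : (s ^ 2) ^ n ≤ eigenvalueG q s n (true, m) := by
  conv_lhs => rw [← Finset.card_range n, ← Finset.prod_const]
  refine Finset.prod_le_prod (fun _ _ => sq_nonneg s) fun k _ => ?_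
  simp only [podlesEigenvalue]
  have : 0 ≤ q ^ (2 * (k : ℤ) - 2 * (n : ℤ)) * q ^ (2 * (m + 1)) := by positivity
  linarith

include hq0 hq1 in
theorem eigenvalueF_nonneg : ∀ i, 0 ≤ eigenvalueF q s n i
  | (false, m) => zero_le_one.trans (one_le_eigenvalueF_false hq0 n m)
  | (true, m) => prod_one_sub_zpow_nonneg hq0 hq1 n m

include hq0 hq1 in
theorem eigenvalueG_nonneg : ∀ i, 0 ≤ eigenvalueG q s n i
  | (false, m) => by
    rw [eigenvalueG_false]
    exact mul_nonneg (by positivity) (prod_one_sub_zpow_nonneg hq0 hq1 n m)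
  | (true, m) => le_trans (by positivity) (pow_le_eigenvalueG_true hq0 n m)

include hq0 hq1 in
theorem min_le_eigenvalueF_add_eigenvalueG :
    ∀ i, min 1 ((s ^ 2) ^ n) ≤ eigenvalueF q s n i + eigenvalueG q s n i
  | (false, m) => by
    linarith [min_le_left 1 ((s ^ 2) ^ n), one_le_eigenvalueF_false (s := s) hq0 n m,
      eigenvalueG_nonneg (s := s) hq0 hq1 n (false, m)]
  | (true, m) => by
    linarith [min_le_right 1 ((s ^ 2) ^ n), pow_le_eigenvalueG_true (s := s) hq0 n m,
      eigenvalueF_nonneg (s := s) hq0 hq1 n (true, m)]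

include hq0 in
theorem eigenvalueF_mul_eigenvalueG_eq_zero {m : ℕ} (h : m < n) :
    ∀ i, eigenvalueF q s n (i, m) * eigenvalueG q s n (i, m) = 0
  | false => by rw [eigenvalueG_false, prod_one_sub_zpow_eq_zero hq0.ne' h, mul_zero, mul_zero]
  | true => mul_eq_zero_of_left (prod_one_sub_zpow_eq_zero hq0.ne' h) _

end Eigenvalues

theorem div_add_sq_add_sqrt_sq {x y : ℝ} (hx : 0 ≤ x) (hy : 0 ≤ y) (hxy : 0 < x + y) :
    x * (x + y)⁻¹ * (x * (x + y)⁻¹) + √(x * y) * (x + y)⁻¹ * (√(x * y) * (x + y)⁻¹) =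
      x * (x + y)⁻¹ := by
  have h := Real.mul_self_sqrt (mul_nonneg hx hy)
  field_simp
  linear_combination h

/-- With the context of the generic Podleś sphere (see statement 4), the 2×2 operator matrix
`Q_{−n}` is a self-adjoint idempotent in the algebra of 2×2 matrices over `B(H ⊕ H)`. -/
theorem stmt5
    (q s : ℝ) (hq0 : 0 < q) (hq1 : q < 1) (hs : 0 < s)
    {K : Type*} [NormedAddCommGroup K] [InnerProductSpace ℂ K] [CompleteSpace K]
    (e : Bool × ℕ → K) (he : Orthonormal ℂ e)
    (htotal : (Submodule.span ℂ (Set.range e)).topologicalClosure = ⊤)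
    (ζ 𝔖 : K →L[ℂ] K)
    (hζm : ∀ m : ℕ, ζ (e (false, m)) = ((-(s ^ 2 * q ^ (2 * (m + 1))) : ℝ) : ℂ) • e (false, m))
    (hζp : ∀ m : ℕ, ζ (e (true, m)) = ((q ^ (2 * (m + 1)) : ℝ) : ℂ) • e (true, m))
    (h𝔖 : ∀ (i : Bool) (m : ℕ), 𝔖 (e (i, m)) = e (i, m + 1))
    (n : ℕ) (hn : 1 ≤ n)
    (fn gn Fn Gn : K →L[ℂ] K)
    (hfn : fn = ((List.range n).map fun k => 1 - ((q ^ (2 * k) : ℝ) : ℂ) • ζ).prod)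
    (hgn : gn = ((List.range n).map fun k => ((s ^ 2 : ℝ) : ℂ) • (1 : K →L[ℂ] K) + ((q ^ (2 * k) : ℝ) : ℂ) • ζ).prod)
    (hFn : Fn = ((List.range n).map fun k => 1 - ((q ^ (2 * (k : ℤ) - 2 * (n : ℤ)) : ℝ) : ℂ) • ζ).prod)
    (hGn : Gn = ((List.range n).map fun k => ((s ^ 2 : ℝ) : ℂ) • (1 : K →L[ℂ] K) + ((q ^ (2 * (k : ℤ) - 2 * (n : ℤ)) : ℝ) : ℂ) • ζ).prod)
    (Q' : Matrix (Fin 2) (Fin 2) (K →L[ℂ] K))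
    (hQ' : Q' = !![Fn * Ring.inverse (Fn + Gn),
                 -(CFC.sqrt (Fn * Gn) * Ring.inverse (Fn + Gn) * 𝔖 ^ n);
                 -(CFC.sqrt (fn * gn) * Ring.inverse (fn + gn) * (star 𝔖) ^ n),
                 gn * Ring.inverse (fn + gn)]) :
    star Q' = Q' ∧ Q' * Q' = Q' := by
  have hb : ⇑(HilbertBasis.mk he htotal.ge) = e := HilbertBasis.coe_mk he htotal.ge
  set b := HilbertBasis.mk he htotal.ge
  rw [← hb] at hζm hζp h𝔖
  have hζ : IsRealDiagonal b ζ (podlesEigenvalue q s)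
    | (false, m) => hζm m
    | (true, m) => hζp m
  have hrange : (do let a ← List.range n; pure (a : ℤ)) =
      List.map (Nat.cast : ℕ → ℤ) (List.range n) := by
    simp [List.map_eq_flatMap]
  rw [hrange, List.map_map] at hFn hGn
  have hF : IsRealDiagonal b Fn (eigenvalueF q s n) := by
    rw [hFn]
    exact .list_prod (fun k => IsRealDiagonal.one.sub (hζ.smul _)) n
  have hG : IsRealDiagonal b Gn (eigenvalueG q s n) := by
    rw [hGn]
    refine IsRealDiagonal.congr (.list_prod (fun k => (IsRealDiagonal.one.smul _).add (hζ.smul _)) n)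
      fun i => ?_
    simp [eigenvalueG]
  have hf : IsRealDiagonal b fn (fun i => eigenvalueF q s n (i.1, i.2 + n)) := by
    rw [hfn]
    refine IsRealDiagonal.congr (.list_prod (fun k => IsRealDiagonal.one.sub (hζ.smul _)) n)
      fun i => ?_
    simp [eigenvalueF, zpow_mul_podlesEigenvalue_add hq0.ne']
  have hg : IsRealDiagonal b gn (fun i => eigenvalueG q s n (i.1, i.2 + n)) := by
    rw [hgn]
    refine IsRealDiagonal.congr (.list_prod (fun k => (IsRealDiagonal.one.smul _).add (hζ.smul _)) n)
      fun i => ?_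
    simp [eigenvalueG, zpow_mul_podlesEigenvalue_add hq0.ne']
  have hF0 := eigenvalueF_nonneg (s := s) hq0 hq1 n
  have hG0 := eigenvalueG_nonneg (s := s) hq0 hq1 n
  have hlow := min_le_eigenvalueF_add_eigenvalueG (s := s) hq0 hq1 n
  have hmin : 0 < min 1 ((s ^ 2) ^ n) := by positivity
  have hpos := fun i => hmin.trans_le (hlow i)
  have hFG := (hF.add hG).inverse hmin hlow
  have hfg := (hf.add hg).inverse hmin fun i => hlow _
  have h := IsRealDiagonal.isStarProjection_matrix h𝔖 n (hF.mul hFG) (hg.mul hfg)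
    (((hF.mul hG).sqrt fun i => mul_nonneg (hF0 i) (hG0 i)).mul hFG)
    (((hf.mul hg).sqrt fun i => mul_nonneg (hF0 _) (hG0 _)).mul hfg)
    (fun _ _ => rfl)
    (fun i m hm => by
      simp [eigenvalueF_mul_eigenvalueG_eq_zero hq0 n hm i])
    (fun i => div_add_sq_add_sqrt_sq (hF0 i) (hG0 i) (hpos i))
    (fun i => by
      have h := div_add_sq_add_sqrt_sq (hG0 (i.1, i.2 + n)) (hF0 (i.1, i.2 + n))
        (by rw [add_comm]; exact hpos _)
      rw [add_comm (eigenvalueG q s n _), mul_comm (eigenvalueG q s n _) (eigenvalueF q s n _),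
        add_comm] at h
      exact h)
    (fun i m => by rw [← add_mul, mul_inv_cancel₀ (hpos _).ne'])
    hQ'
  exact ⟨h.isSelfAdjoint, h.isIdempotentElem⟩
end

section
/- For every integer n ≥ 1, Q_n + Q_{−n} = 1 in the algebra of 2×2 matrices over B(H ⊕ H); that is, Q_n and Q_{−n} are complementary projections. (This implies that the direct sum of the quantum line bundles with winding numbers n and −n is a free module of rank 2.) -/
set_option synthInstance.maxHeartbeats 1000000
set_option maxHeartbeats 1000000

open Filter Topology

theorem exists_pos_le_of_tendsto {u : ℕ → ℝ} {l : ℝ} (hu : Tendsto u atTop (𝓝 l)) (hl : 0 < l)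
    (hpos : ∀ m, 0 < u m) : ∃ c, 0 < c ∧ ∀ m, c ≤ u m := by
  obtain ⟨B, hB⟩ := (hu.inv₀ hl.ne').bddAbove_range
  have hB' : ∀ m, (u m)⁻¹ ≤ B := fun m => hB ⟨m, rfl⟩
  have hB0 : 0 < B := (inv_pos.2 (hpos 0)).trans_le (hB' 0)
  exact ⟨B⁻¹, inv_pos.2 hB0, fun m => inv_le_of_inv_le₀ (hpos m) (hB' m)⟩

section DiagonalOperators

variable {K : Type*} [NormedAddCommGroup K] [InnerProductSpace ℂ K]

theorem prod_map_range_apply_eigenvector (T : ℕ → K →L[ℂ] K) (c : ℕ → ℝ) (x : K)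
    (hT : ∀ k, T k x = (c k : ℂ) • x) (n : ℕ) :
    ((List.range n).map T).prod x = ((∏ k ∈ Finset.range n, c k : ℝ) : ℂ) • x := by
  induction n with
  | zero => simp
  | succ n ih =>
    rw [List.range_succ, List.map_append, List.prod_append, Finset.prod_range_succ]
    simp [hT, ih, smul_smul, mul_comm, -Complex.coe_smul]

theorem isUnit_of_diagonal [CompleteSpace K] {ι : Type*} {e : ι → K} (he : Orthonormal ℂ e)
    (htotal : (Submodule.span ℂ (Set.range e)).topologicalClosure = ⊤)
    (T : K →L[ℂ] K) (d : ι → ℝ) (hT : ∀ i, T (e i) = (d i : ℂ) • e i)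
    {c : ℝ} (hc : 0 < c) (hd : ∀ i, c ≤ d i) : IsUnit T := by
  have hcoord : ∀ i x, inner ℂ (e i) (T x) = (d i : ℂ) * inner ℂ (e i) x := by
    intro i x
    have h : (innerSL ℂ (e i)) ∘L T = (d i : ℂ) • innerSL ℂ (e i) := by
      refine ContinuousLinearMap.ext_on (s := Set.range e) ?_ ?_
      · exact Submodule.dense_iff_topologicalClosure_eq_top.2 htotal
      · rintro _ ⟨j, rfl⟩
        by_cases hij : i = j
        · subst hij
          simp [hT]
        · simp [hT, he.2 hij]
    simpa using DFunLike.congr_fun h x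
  let b := HilbertBasis.mk he htotal.ge
  have hb : ∀ i, b i = e i := fun i => by simp [b]
  refine ContinuousLinearMap.isUnit_of_forall_le_norm_inner_map T (c := ⟨c, hc.le⟩) hc fun x => ?_
  have h₁ := Complex.hasSum_re (b.hasSum_inner_mul_inner x (T x))
  have h₂ := (Complex.hasSum_re (b.hasSum_inner_mul_inner x x)).mul_left c
  have key : c * (inner ℂ x x : ℂ).re ≤ (inner ℂ x (T x) : ℂ).re := by
    refine hasSum_le (fun i => ?_) h₂ h₁
    have hsq : inner ℂ x (e i) * inner ℂ (e i) x = ((‖(inner ℂ (e i) x : ℂ)‖ ^ 2 : ℝ) : ℂ) := by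
      rw [← inner_conj_symm x (e i), Complex.conj_mul']
      push_cast
      rfl
    rw [hb, hcoord, mul_left_comm, hsq, ← Complex.ofReal_mul, Complex.ofReal_re, Complex.ofReal_re]
    exact mul_le_mul_of_nonneg_right (hd i) (sq_nonneg _)
  have hself : (inner ℂ x x : ℂ).re = ‖x‖ ^ 2 := inner_self_eq_norm_sq (𝕜 := ℂ) x
  calc ‖x‖ ^ 2 * c = c * (inner ℂ x x : ℂ).re := by rw [hself, mul_comm]
    _ ≤ (inner ℂ x (T x) : ℂ).re := key
    _ ≤ ‖(inner ℂ x (T x) : ℂ)‖ := Complex.re_le_norm _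
    _ = ‖(inner ℂ (T x) x : ℂ)‖ := norm_inner_symm _ _

theorem isUnit_prod_add_prod [CompleteSpace K] {q s : ℝ} (hq0 : 0 < q) (hq1 : q < 1) (hs : 0 < s)
    {e : Bool × ℕ → K} (he : Orthonormal ℂ e)
    (htotal : (Submodule.span ℂ (Set.range e)).topologicalClosure = ⊤) {ζ : K →L[ℂ] K}
    (hζm : ∀ m : ℕ, ζ (e (false, m)) = ((-(s ^ 2 * q ^ (2 * (m + 1))) : ℝ) : ℂ) • e (false, m))
    (hζp : ∀ m : ℕ, ζ (e (true, m)) = ((q ^ (2 * (m + 1)) : ℝ) : ℂ) • e (true, m))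
    (n : ℕ) (a : ℕ → ℝ) (ha : ∀ k, 0 < a k)
    (hnonneg : ∀ m : ℕ, 0 ≤ ∏ k ∈ Finset.range n, (1 - a k * q ^ (2 * (m + 1)))) :
    IsUnit (((List.range n).map fun k => 1 - (a k : ℂ) • ζ).prod +
      ((List.range n).map fun k => ((s ^ 2 : ℝ) : ℂ) • (1 : K →L[ℂ] K) + (a k : ℂ) • ζ).prod) := by
  let z : Bool × ℕ → ℝ := fun i => cond i.1 1 (-s ^ 2) * q ^ (2 * (i.2 + 1))
  let p : ℝ → ℝ := fun t =>
    ∏ k ∈ Finset.range n, (1 - a k * t) + ∏ k ∈ Finset.range n, (s ^ 2 + a k * t)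
  have hζ : ∀ i, ζ (e i) = (z i : ℂ) • e i := by
    rintro ⟨_ | _, m⟩
    · simp only [z, hζm, cond_false, neg_mul]
    · simp only [z, hζp, cond_true, one_mul]
  have hp : ∀ i, 0 < p (z i) := by
    rintro ⟨_ | _, m⟩
    · refine add_pos_of_pos_of_nonneg (Finset.prod_pos fun k _ => ?_) ?_
      · have := ha k
        simp only [z, cond_false, neg_mul, mul_neg, sub_neg_eq_add]
        positivity
      · have h : ∀ k, s ^ 2 + a k * z (false, m) = s ^ 2 * (1 - a k * q ^ (2 * (m + 1))) := by
          intro k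
          simp only [z, cond_false]
          ring
        simp only [h, Finset.prod_mul_distrib]
        exact mul_nonneg (Finset.prod_nonneg fun _ _ => sq_nonneg s) (hnonneg m)
    · refine add_pos_of_nonneg_of_pos ?_ (Finset.prod_pos fun k _ => ?_)
      · simpa only [z, cond_true, one_mul] using hnonneg m
      · have := ha k
        simp only [z, cond_true, one_mul]
        positivity
  have hbound : ∀ b, ∃ c, 0 < c ∧ ∀ m, c ≤ p (z (b, m)) := by
    intro b
    have hz : Tendsto (fun m => z (b, m)) atTop (𝓝 0) := by
      have h : Tendsto (fun m : ℕ => q ^ (2 * (m + 1))) atTop (𝓝 0) :=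
        (tendsto_pow_atTop_nhds_zero_of_lt_one hq0.le hq1).comp
          (tendsto_atTop_mono (fun m => show m ≤ 2 * (m + 1) by omega) tendsto_id)
      simpa only [mul_zero] using h.const_mul (cond b 1 (-s ^ 2))
    have hcont : Continuous p := by fun_prop
    refine exists_pos_le_of_tendsto ((hcont.tendsto 0).comp hz) ?_ fun m => hp (b, m)
    simp only [p, mul_zero, sub_zero, add_zero]
    positivity
  obtain ⟨c, hc, hcle⟩ := hbound false
  obtain ⟨c', hc', hcle'⟩ := hbound true
  refine isUnit_of_diagonal he htotal _ (fun i => p (z i)) (fun i => ?_) (lt_min hc hc') ?_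
  · rw [add_apply,
      prod_map_range_apply_eigenvector _ (fun k => 1 - a k * z i) (e i) (fun k => ?_),
      prod_map_range_apply_eigenvector _ (fun k => s ^ 2 + a k * z i) (e i) (fun k => ?_),
      ← add_smul, ← Complex.ofReal_add]
    · simp [hζ, add_smul, smul_smul, -Complex.coe_smul]
    · simp [hζ, sub_smul, smul_smul, -Complex.coe_smul]
  · rintro ⟨_ | _, m⟩
    · exact (min_le_left _ _).trans (hcle m)
    · exact (min_le_right _ _).trans (hcle' m)

end DiagonalOperators

/-- With the context of the generic Podleś sphere (see statement 4), the 2×2 operator matrices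
`Q_n` and `Q_{−n}` satisfy `Q_n + Q_{−n} = 1`, i.e. they are complementary projections
(whence the direct sum of the quantum line bundles of winding numbers `n` and `−n` is a
free module of rank 2). -/
theorem stmt6
    (q s : ℝ) (hq0 : 0 < q) (hq1 : q < 1) (hs : 0 < s)
    {K : Type*} [NormedAddCommGroup K] [InnerProductSpace ℂ K] [CompleteSpace K]
    (e : Bool × ℕ → K) (he : Orthonormal ℂ e)
    (htotal : (Submodule.span ℂ (Set.range e)).topologicalClosure = ⊤)
    (ζ 𝔖 : K →L[ℂ] K)
    (hζm : ∀ m : ℕ, ζ (e (false, m)) = ((-(s ^ 2 * q ^ (2 * (m + 1))) : ℝ) : ℂ) • e (false, m))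
    (hζp : ∀ m : ℕ, ζ (e (true, m)) = ((q ^ (2 * (m + 1)) : ℝ) : ℂ) • e (true, m))
    (h𝔖 : ∀ (i : Bool) (m : ℕ), 𝔖 (e (i, m)) = e (i, m + 1))
    (n : ℕ) (hn : 1 ≤ n)
    (fn gn Fn Gn : K →L[ℂ] K)
    (hfn : fn = ((List.range n).map fun k => 1 - ((q ^ (2 * k) : ℝ) : ℂ) • ζ).prod)
    (hgn : gn = ((List.range n).map fun k => ((s ^ 2 : ℝ) : ℂ) • (1 : K →L[ℂ] K) + ((q ^ (2 * k) : ℝ) : ℂ) • ζ).prod)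
    (hFn : Fn = ((List.range n).map fun k => 1 - ((q ^ (2 * (k : ℤ) - 2 * (n : ℤ)) : ℝ) : ℂ) • ζ).prod)
    (hGn : Gn = ((List.range n).map fun k => ((s ^ 2 : ℝ) : ℂ) • (1 : K →L[ℂ] K) + ((q ^ (2 * (k : ℤ) - 2 * (n : ℤ)) : ℝ) : ℂ) • ζ).prod)
    (Q Q' : Matrix (Fin 2) (Fin 2) (K →L[ℂ] K))
    (hQ : Q = !![Gn * Ring.inverse (Fn + Gn),
                 CFC.sqrt (Fn * Gn) * Ring.inverse (Fn + Gn) * 𝔖 ^ n;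
                 CFC.sqrt (fn * gn) * Ring.inverse (fn + gn) * (star 𝔖) ^ n,
                 fn * Ring.inverse (fn + gn)])
    (hQ' : Q' = !![Fn * Ring.inverse (Fn + Gn),
                 -(CFC.sqrt (Fn * Gn) * Ring.inverse (Fn + Gn) * 𝔖 ^ n);
                 -(CFC.sqrt (fn * gn) * Ring.inverse (fn + gn) * (star 𝔖) ^ n),
                 gn * Ring.inverse (fn + gn)]) :
    Q + Q' = 1 := by
  have hf : IsUnit (fn + gn) := by
    rw [hfn, hgn]
    refine isUnit_prod_add_prod hq0 hq1 hs he htotal hζm hζp n (fun k => q ^ (2 * k))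
      (fun k => by positivity) fun m => Finset.prod_nonneg fun k _ => ?_
    rw [← pow_add, sub_nonneg]
    exact pow_le_one₀ hq0.le hq1.le
  have hF : IsUnit (Fn + Gn) := by
    rw [hFn, hGn]
    simp only [bind_pure_comp, List.map_eq_map, List.map_map]
    refine isUnit_prod_add_prod hq0 hq1 hs he htotal hζm hζp n
      (fun k => q ^ (2 * (k : ℤ) - 2 * (n : ℤ))) (fun k => by positivity) fun m => ?_
    have h : ∀ k : ℕ, q ^ (2 * (k : ℤ) - 2 * (n : ℤ)) * q ^ (2 * (m + 1)) =
        q ^ (2 * ((k : ℤ) + m + 1 - n)) := by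
      intro k
      rw [← zpow_natCast, ← zpow_add₀ hq0.ne']
      congr 1
      push_cast
      ring
    simp only [h]
    rcases lt_or_ge m n with hmn | hmn
    · refine (Finset.prod_eq_zero (i := n - 1 - m) (Finset.mem_range.2 (by omega)) ?_).ge
      rw [show 2 * (((n - 1 - m : ℕ) : ℤ) + m + 1 - n) = 0 by omega, zpow_zero, sub_self]
    · refine Finset.prod_nonneg fun k _ => ?_
      rw [sub_nonneg]
      exact zpow_le_one₀ hq0 hq1.le (by omega)
  subst hQ hQ'
  ext1 i j
  fin_cases i <;> fin_cases j
  · simp [← add_mul, add_comm Gn Fn, Ring.mul_inverse_cancel _ hF]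
  · simp
  · simp
  · simp [← add_mul, Ring.mul_inverse_cancel _ hf]
end

section
/- For every integer n ≥ 1, the following identities hold in A: u_n·ζ_{qⁿs} = ζ_s·u_n, w_n·ζ_{qⁿs} = q^{2n}·ζ_s·w_n, u_{−n}·ζ_{q^{−n}s} = q^{−2n}·ζ_s·u_{−n}, w_{−n}·ζ_{q^{−n}s} = ζ_s·w_{−n}, u_n·η_{qⁿs} = qⁿ·η_s·u_n, and u_{−n}·η_{q^{−n}s} = q^{−n}·η_s·u_{−n}. -/
theorem List.prod_map_range_mul_of_twisted_comm {K A : Type*} [CommRing K] [Ring A] [Algebra K A]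
    (f Z : ℕ → A) (c : K) (h : ∀ k, f k * Z (k + 1) = c • (Z k * f k)) (n : ℕ) :
    ((List.range n).map f).prod * Z n = c ^ n • (Z 0 * ((List.range n).map f).prod) := by
  induction n with
  | zero => simp
  | succ n ih =>
    rw [List.range_succ, List.map_append, List.prod_append]
    simp only [List.map_cons, List.map_nil, List.prod_cons, List.prod_nil, mul_one]
    rw [mul_assoc, h, mul_smul_comm, ← mul_assoc, ih, smul_mul_assoc, smul_smul, pow_succ',
      mul_assoc]

/-- The twisted commutation rules for a single factor, at an arbitrary parameter `t`. -/
theorem quantumSU2_twisted_comm {K A : Type*} [Field K] [Ring A] [Algebra K A]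
    (q t : K) (hq : q ≠ 0) (α β γ δ : A)
    (hαβ : α * β = q • (β * α)) (hαγ : α * γ = q • (γ * α))
    (hβδ : β * δ = q • (δ * β)) (hγδ : γ * δ = q • (δ * γ))
    (hβγ : β * γ = γ * β)
    (hαδ : α * δ - q • (β * γ) = 1) (hδα : δ * α - q⁻¹ • (β * γ) = 1)
    (ζ η : K → A)
    (hζ : ∀ t, ζ t = 1 - (α - (q * t) • γ) * (δ + t • β))
    (hη : ∀ t, η t = (δ + (q⁻¹ * t) • β) * (β - t • δ)) :
    (β - (q * t) • δ) * ζ (q * t) = (1 : K) • (ζ t * (β - (q * t) • δ)) ∧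
    (α - (q * t) • γ) * ζ (q * t) = (q ^ 2) • (ζ t * (α - (q * t) • γ)) ∧
    (δ + (q⁻¹ * t) • β) * ζ (q⁻¹ * t) = (q ^ 2)⁻¹ • (ζ t * (δ + (q⁻¹ * t) • β)) ∧
    (γ + (q⁻¹ * t) • α) * ζ (q⁻¹ * t) = (1 : K) • (ζ t * (γ + (q⁻¹ * t) • α)) ∧
    (β - (q * t) • δ) * η (q * t) = q • (η t * (β - (q * t) • δ)) ∧
    (δ + (q⁻¹ * t) • β) * η (q⁻¹ * t) = q⁻¹ • (η t * (δ + (q⁻¹ * t) • β)) := by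
  have reassoc {x y z : A} (h : x * y = z) (w : A) : x * (y * w) = z * w := by
    rw [← mul_assoc, h]
  have hδβ : δ * β = q⁻¹ • (β * δ) := by rw [hβδ, smul_smul, inv_mul_cancel₀ hq, one_smul]
  have hδγ : δ * γ = q⁻¹ • (γ * δ) := by rw [hγδ, smul_smul, inv_mul_cancel₀ hq, one_smul]
  have hαδ' : α * δ = 1 + q • (β * γ) := by rw [← hαδ]; abel
  have hδα' : δ * α = 1 + q⁻¹ • (β * γ) := by rw [← hδα]; abel
  set_option linter.unusedSimpArgs false in
  refine ⟨?_, ?_, ?_, ?_, ?_, ?_⟩ <;>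
  · simp only [hζ, hη, mul_add, add_mul, mul_sub, sub_mul, smul_mul_assoc, mul_smul_comm,
      mul_one, one_mul, mul_assoc, smul_add, smul_sub, smul_smul,
      hαβ, hαγ, hδβ, hδγ, ← hβγ, hαδ', hδα',
      reassoc hαβ, reassoc hαγ, reassoc hδβ, reassoc hδγ, reassoc hβγ.symm, reassoc hαδ',
      reassoc hδα']
    match_scalars <;> field_simp <;> ring


/-- part of Lemma 2.4 of the paper.
`A` is a complex star-algebra containing generators `α, β, γ, δ` of `O(SU_q(2))`; `ζ_t` and
`η_t` are the Podleś-sphere elements for the parameter `t ≥ 0`, and `u_{±n}, w_{±n}` are the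
highest/lowest weight vectors (here `u' m` stands for `u_{−m}` and `w' m` for `w_{−m}`).
Then for every `n ≥ 1`:  `u_n ζ_{qⁿs} = ζ_s u_n`,  `w_n ζ_{qⁿs} = q^{2n} ζ_s w_n`,
`u_{−n} ζ_{q^{−n}s} = q^{−2n} ζ_s u_{−n}`,  `w_{−n} ζ_{q^{−n}s} = ζ_s w_{−n}`,
`u_n η_{qⁿs} = qⁿ η_s u_n`  and  `u_{−n} η_{q^{−n}s} = q^{−n} η_s u_{−n}`. -/
theorem stmt11
    (q s : ℝ) (hq0 : 0 < q) (hq1 : q < 1) (hs : 0 < s)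
    {A : Type*} [Ring A] [Algebra ℂ A] [StarRing A] [StarModule ℂ A]
    (α β γ δ : A)
    (hαβ : α * β = (q : ℂ) • (β * α)) (hαγ : α * γ = (q : ℂ) • (γ * α))
    (hβδ : β * δ = (q : ℂ) • (δ * β)) (hγδ : γ * δ = (q : ℂ) • (δ * γ))
    (hβγ : β * γ = γ * β)
    (hαδ : α * δ - (q : ℂ) • (β * γ) = 1)
    (hδα : δ * α - ((q : ℂ))⁻¹ • (β * γ) = 1)
    (hαst : star α = δ) (hβst : star β = -((q : ℂ) • γ))
    (hγst : star γ = -(((q : ℂ))⁻¹ • β)) (hδst : star δ = α)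
    (ζ η : ℝ → A)
    (hζ : ∀ t : ℝ, ζ t = 1 - (α - ((q * t : ℝ) : ℂ) • γ) * (δ + ((t : ℝ) : ℂ) • β))
    (hη : ∀ t : ℝ, η t = (δ + ((q⁻¹ * t : ℝ) : ℂ) • β) * (β - ((t : ℝ) : ℂ) • δ))
    (u w u' w' : ℕ → A)
    (hu : ∀ m : ℕ, u m =
      (((q : ℂ) ^ m)⁻¹) • ((List.range m).map fun k => β - ((q ^ (k + 1) * s : ℝ) : ℂ) • δ).prod)
    (hu' : ∀ m : ℕ, u' m =
      ((List.range m).map fun k => δ + ((q ^ (-(k + 1 : ℤ)) * s : ℝ) : ℂ) • β).prod)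
    (hw : ∀ m : ℕ, w m =
      ((List.range m).map fun k => α - ((q ^ (k + 1) * s : ℝ) : ℂ) • γ).prod)
    (hw' : ∀ m : ℕ, w' m =
      ((((-q : ℝ) ^ m : ℝ)) : ℂ) • ((List.range m).map fun k => γ + ((q ^ (-(k + 1 : ℤ)) * s : ℝ) : ℂ) • α).prod)
    (n : ℕ) (hn : 1 ≤ n)
    :
    u n * ζ (q ^ n * s) = ζ s * u n ∧
    w n * ζ (q ^ n * s) = ((q : ℂ) ^ (2 * n)) • (ζ s * w n) ∧
    u' n * ζ (q ^ (-(n : ℤ)) * s) = (((q : ℂ) ^ (2 * n))⁻¹) • (ζ s * u' n) ∧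
    w' n * ζ (q ^ (-(n : ℤ)) * s) = ζ s * w' n ∧
    u n * η (q ^ n * s) = ((q : ℂ) ^ n) • (η s * u n) ∧
    u' n * η (q ^ (-(n : ℤ)) * s) = (((q : ℂ) ^ n)⁻¹) • (η s * u' n) := by
  have hq : (q : ℂ) ≠ 0 := by exact_mod_cast hq0.ne'
  -- Extend `ζ` and `η` to complex parameters.
  let Z : ℂ → A := fun t => 1 - (α - ((q : ℂ) * t) • γ) * (δ + t • β)
  let H : ℂ → A := fun t => (δ + ((q : ℂ)⁻¹ * t) • β) * (β - t • δ)
  have hζZ : ∀ t : ℝ, ζ t = Z t := fun t => by simp [hζ, Z]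
  have hηH : ∀ t : ℝ, η t = H t := fun t => by simp [hη, H]
  have key := fun t : ℂ => quantumSU2_twisted_comm (q : ℂ) t hq α β γ δ hαβ hαγ hβδ hγδ hβγ hαδ hδα
    Z H (fun _ => rfl) (fun _ => rfl)
  have hpos : ∀ k : ℕ, ((q ^ (k + 1) * s : ℝ) : ℂ) = q * ((q ^ k * s : ℝ) : ℂ) := fun k => by
    push_cast; ring
  have hneg : ∀ k : ℕ, ((q ^ (-(k + 1 : ℤ)) * s : ℝ) : ℂ)
      = (q : ℂ)⁻¹ * ((q ^ (-(k : ℤ)) * s : ℝ) : ℂ) := fun k => by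
    rw [neg_add, zpow_add₀ hq0.ne']; push_cast; rw [zpow_neg_one]; ring
  have hpos' (F : ℂ → A) (f : ℕ → A) (c : ℂ)
      (h : ∀ k, f k * F (q * ((q ^ k * s : ℝ) : ℂ)) = c • (F ((q ^ k * s : ℝ) : ℂ) * f k)) :
      ((List.range n).map f).prod * F ((q ^ n * s : ℝ) : ℂ)
        = c ^ n • (F s * ((List.range n).map f).prod) := by
    simpa using List.prod_map_range_mul_of_twisted_comm f
      (fun k => F ((q ^ k * s : ℝ) : ℂ)) c (fun k => by rw [hpos]; exact h k) n
  have hneg' (F : ℂ → A) (f : ℕ → A) (c : ℂ)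
      (h : ∀ k : ℕ, f k * F ((q : ℂ)⁻¹ * ((q ^ (-(k : ℤ)) * s : ℝ) : ℂ))
        = c • (F ((q ^ (-(k : ℤ)) * s : ℝ) : ℂ) * f k)) :
      ((List.range n).map f).prod * F ((q ^ (-(n : ℤ)) * s : ℝ) : ℂ)
        = c ^ n • (F s * ((List.range n).map f).prod) := by
    simpa using List.prod_map_range_mul_of_twisted_comm f
      (fun k => F ((q ^ (-(k : ℤ)) * s : ℝ) : ℂ)) c
      (fun k => by rw [Nat.cast_succ, hneg]; exact h k) n
  -- The factors of `u'` and `w'` are indexed by integers; reindex them by naturals.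
  have hcast (f : ℤ → A) (m : ℕ) : (List.map f do let a ← List.range m; pure (a : ℤ))
      = (List.range m).map fun k : ℕ => f k := by
    rw [← Function.comp_def f, ← List.map_map]; simp [List.map_eq_flatMap]
  simp only [hcast] at hu' hw'
  simp only [hζZ, hηH, hu, hu', hw, hw', smul_mul_assoc, mul_smul_comm]
  refine ⟨?_, ?_, ?_, ?_, ?_, ?_⟩
  · rw [hpos' Z _ 1 fun k => by rw [hpos]; exact (key _).1, one_pow, one_smul]
  · rw [hpos' Z _ _ fun k => by rw [hpos]; exact (key _).2.1, pow_mul]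
  · rw [hneg' Z _ _ fun k => by rw [hneg]; exact (key _).2.2.1, inv_pow, pow_mul]
  · rw [hneg' Z _ 1 fun k => by rw [hneg]; exact (key _).2.2.2.1, one_pow, one_smul]
  · rw [hpos' H _ _ fun k => by rw [hpos]; exact (key _).2.2.2.2.1, smul_comm]
  · rw [hneg' H _ _ fun k => by rw [hneg]; exact (key _).2.2.2.2.2, inv_pow]
end

section
/- For every integer n ≥ 1, the following identities hold in A: u_n·w_n* = q^{n(n−1)/2}·η_sⁿ and u_{−n}·w_{−n}* = q^{−n(n−1)/2}·η_sⁿ. -/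
/-- If `f (k + 1) * g (k + 1) = c • (g k * f k)` for all `k`, then the nested product
`f 0 ⋯ f (n - 1) * (g (n - 1) ⋯ g 0)` is a scalar multiple of `(f 0 * g 0) ^ n`. -/
theorem prod_range_mul_prod_reverse_range {R A : Type*} [CommRing R] [Ring A] [Algebra R A]
    (c : R) (n : ℕ) (f g : ℕ → A) (h : ∀ k, f (k + 1) * g (k + 1) = c • (g k * f k)) :
    ((List.range n).map f).prod * ((List.range n).map g).reverse.prod =
      c ^ (n * (n - 1) / 2) • (f 0 * g 0) ^ n := by
  induction n generalizing f g with
  | zero => simp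
  | succ n ih =>
    have ih' := ih (fun k => f (k + 1)) (fun k => g (k + 1)) fun k => h (k + 1)
    have hexp : (n + 1) * (n + 1 - 1) / 2 = n * (n - 1) / 2 + n := by
      simpa [Finset.sum_range_id] using Finset.sum_range_succ (fun i => i) n
    have hshift : f 0 * (g 0 * f 0) ^ n * g 0 = (f 0 * g 0) ^ (n + 1) := by
      rw [pow_succ, ← mul_assoc]
      congr 1
      exact (SemiconjBy.pow_right (show SemiconjBy (f 0) (g 0 * f 0) (f 0 * g 0) from
        (mul_assoc _ _ _).symm) n)
    rw [List.range_succ_eq_map, hexp]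
    simp only [List.map_cons, List.prod_cons, List.map_map, List.reverse_cons, List.prod_append,
      List.prod_nil, mul_one]
    calc _ = f 0 * (((List.range n).map fun k => f (k + 1)).prod *
          ((List.range n).map fun k => g (k + 1)).reverse.prod) * g 0 := by
            simp only [mul_assoc]; rfl
      _ = _ := by
        rw [ih', h 0, smul_pow, smul_smul, ← pow_add, mul_smul_comm, smul_mul_assoc, hshift]

/-- `star` reverses list products. -/
theorem star_list_prod {A : Type*} [Semiring A] [StarRing A] (l : List A) :
    star l.prod = (l.map star).reverse.prod := by
  induction l with
  | nil => simp
  | cons a l ih => simp [ih]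

/-- Exchange relation between linear combinations of two `q`-commuting elements. -/
theorem qcomm_exchange {K A : Type*} [Field K] [Ring A] [Algebra K A] {q : K} {β δ : A} (h : β * δ = q • (δ * β)) (a b : K) :
    (β - (q * a) • δ) * (δ + (q * b) • β) = q • ((δ + b • β) * (β - a • δ)) := by
  simp only [sub_mul, mul_add, add_mul, mul_sub, smul_mul_assoc, mul_smul_comm, h]
  module

/-- part of Lemma 2.4 of the paper.
With the `O(SU_q(2))` context as in statement 11 (`u' m = u_{−m}`, `w' m = w_{−m}`),
for every `n ≥ 1`:  `u_n w_n* = q^{n(n−1)/2} η_sⁿ`  and  `u_{−n} w_{−n}* = q^{−n(n−1)/2} η_sⁿ`. -/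
theorem stmt12
    (q s : ℝ) (hq0 : 0 < q) (hq1 : q < 1) (hs : 0 < s)
    {A : Type*} [Ring A] [Algebra ℂ A] [StarRing A] [StarModule ℂ A]
    (α β γ δ : A)
    (hαβ : α * β = (q : ℂ) • (β * α)) (hαγ : α * γ = (q : ℂ) • (γ * α))
    (hβδ : β * δ = (q : ℂ) • (δ * β)) (hγδ : γ * δ = (q : ℂ) • (δ * γ))
    (hβγ : β * γ = γ * β)
    (hαδ : α * δ - (q : ℂ) • (β * γ) = 1)
    (hδα : δ * α - ((q : ℂ))⁻¹ • (β * γ) = 1)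
    (hαst : star α = δ) (hβst : star β = -((q : ℂ) • γ))
    (hγst : star γ = -(((q : ℂ))⁻¹ • β)) (hδst : star δ = α)
    (ζ η : ℝ → A)
    (hζ : ∀ t : ℝ, ζ t = 1 - (α - ((q * t : ℝ) : ℂ) • γ) * (δ + ((t : ℝ) : ℂ) • β))
    (hη : ∀ t : ℝ, η t = (δ + ((q⁻¹ * t : ℝ) : ℂ) • β) * (β - ((t : ℝ) : ℂ) • δ))
    (u w u' w' : ℕ → A)
    (hu : ∀ m : ℕ, u m =
      (((q : ℂ) ^ m)⁻¹) • ((List.range m).map fun k => β - ((q ^ (k + 1) * s : ℝ) : ℂ) • δ).prod)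
    (hu' : ∀ m : ℕ, u' m =
      ((List.range m).map fun k => δ + ((q ^ (-(k + 1 : ℤ)) * s : ℝ) : ℂ) • β).prod)
    (hw : ∀ m : ℕ, w m =
      ((List.range m).map fun k => α - ((q ^ (k + 1) * s : ℝ) : ℂ) • γ).prod)
    (hw' : ∀ m : ℕ, w' m =
      ((((-q : ℝ) ^ m : ℝ)) : ℂ) • ((List.range m).map fun k => γ + ((q ^ (-(k + 1 : ℤ)) * s : ℝ) : ℂ) • α).prod)
    (n : ℕ) (hn : 1 ≤ n)
    :
    u n * star (w n) = ((q : ℂ) ^ (n * (n - 1) / 2)) • (η s) ^ n ∧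
    u' n * star (w' n) = (((q : ℂ) ^ (n * (n - 1) / 2))⁻¹) • (η s) ^ n := by
  have hq : (q : ℂ) ≠ 0 := by exact_mod_cast hq0.ne'
  have hx := qcomm_exchange hβδ
  have hη0 : η s = (δ + ((q : ℂ)⁻¹ * s) • β) * (β - (s : ℂ) • δ) := by
    rw [hη]; push_cast; rfl
  constructor
  · have hstar : star ∘ (fun k : ℕ => α - ((q ^ (k + 1) * s : ℝ) : ℂ) • γ) =
        fun k : ℕ => δ + ((q : ℂ) ^ k * s) • β := by
      funext k
      simp only [Function.comp_apply, star_sub, star_smul, hαst, hγst, Complex.star_def,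
        Complex.conj_ofReal, smul_neg, sub_neg_eq_add, smul_smul]
      congr 2
      push_cast
      field_simp
      ring
    rw [hu, hw, star_list_prod, List.map_map, hstar, smul_mul_assoc,
      prod_range_mul_prod_reverse_range (q : ℂ)]
    · have h0 := hx s ((q : ℂ)⁻¹ * s)
      rw [mul_inv_cancel_left₀ hq, ← hη0] at h0
      have h1 : (β - ((q ^ (0 + 1) * s : ℝ) : ℂ) • δ) * (δ + ((q : ℂ) ^ 0 * s) • β) =
          (q : ℂ) • η s := by
        rw [← h0]; simp
      rw [h1, smul_pow, smul_comm, smul_smul ((q : ℂ) ^ n)⁻¹, inv_mul_cancel₀ (pow_ne_zero n hq),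
        one_smul]
    · intro k
      have h0 := hx ((q : ℂ) ^ (k + 1) * s) ((q : ℂ) ^ k * s)
      push_cast
      rw [← h0]
      congr 3
      rw [pow_succ' (q : ℂ) (k + 1), mul_assoc]
      rw [pow_succ', mul_assoc]
  · have hstar : star ∘ (fun k : ℕ => γ + ((q ^ (-(k + 1 : ℤ)) * s : ℝ) : ℂ) • α) =
        fun k : ℕ => (-(q : ℂ)⁻¹) • (β - (((q : ℂ)⁻¹) ^ k * s) • δ) := by
      funext k
      simp only [Function.comp_apply, star_add, star_smul, hαst, hγst, Complex.star_def,
        Complex.conj_ofReal, smul_sub, smul_smul, neg_smul, neg_mul, sub_neg_eq_add]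
      congr 2
      push_cast
      rw [zpow_neg, inv_pow, ← Nat.cast_succ, zpow_natCast, pow_succ]
      field_simp
    have hinv (k : ℕ) : ((q ^ (-(k + 1 : ℤ)) * s : ℝ) : ℂ) = ((q : ℂ)⁻¹) ^ (k + 1) * s := by
      push_cast
      rw [zpow_neg, inv_pow, ← Nat.cast_succ, zpow_natCast]
    have hsmul (m : ℕ) (g : ℕ → A) (c : ℂ) :
        ((List.range m).map fun k => c • g k).reverse.prod =
          c ^ m • ((List.range m).map g).reverse.prod := by
      induction m with
      | zero => simp
      | succ m ih =>
        simp [List.range_succ, ih, smul_smul, pow_succ' c m, mul_comm (c ^ m) c]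
    have hcast (m : ℕ) (F : ℤ → A) :
        (List.map F (do let a ← List.range m; pure (a : ℤ))).prod =
          ((List.range m).map fun k : ℕ => F k).prod := by
      congr 1
      simp [← List.map_eq_flatMap, Function.comp_def]
    rw [hu', hw', hcast, hcast, star_smul, star_list_prod, List.map_map, hstar, hsmul, smul_smul,
      Complex.star_def, Complex.conj_ofReal]
    have hone : (((-q : ℝ) ^ n : ℝ) : ℂ) * (-(q : ℂ)⁻¹) ^ n = 1 := by
      push_cast
      rw [← mul_pow, neg_mul_neg, mul_inv_cancel₀ hq, one_pow]
    simp only [hinv]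
    rw [hone, one_smul, prod_range_mul_prod_reverse_range (q : ℂ)⁻¹, inv_pow, hη0]
    · simp
    · intro k
      have h0 := hx (((q : ℂ)⁻¹) ^ (k + 1) * s) (((q : ℂ)⁻¹) ^ (k + 2) * s)
      have e (j : ℕ) : (q : ℂ) * (((q : ℂ)⁻¹) ^ (j + 1) * s) = ((q : ℂ)⁻¹) ^ j * s := by
        rw [pow_succ']; field_simp
      rw [e, e] at h0
      rw [h0, smul_smul, inv_mul_cancel₀ hq, one_smul]
end

section
/- For every integer n ≥ 1, the following identities hold in A: u_n·u_n* = q^{−2n}·(q²s² + ζ_s)(q⁴s² + ζ_s)⋯(q^{2n}s² + ζ_s), w_n·w_n* = (1 − ζ_s)(1 − q²ζ_s)⋯(1 − q^{2(n−1)}ζ_s), u_{−n}·u_{−n}* = (1 − q^{−2}ζ_s)(1 − q^{−4}ζ_s)⋯(1 − q^{−2n}ζ_s), and w_{−n}·w_{−n}* = (s² + ζ_s)(q^{−2}s² + ζ_s)⋯(q^{−2(n−1)}s² + ζ_s). -/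
/-- If `x k` intertwines `z (k + 1)` with `c • z k` and `x k * star (x k)` is affine in `z k`, then
`x 0 ⋯ x (n - 1)` times its adjoint is a product of affine factors in `z 0`. -/
lemma prod_range_mul_star_of_intertwine {A : Type*} [Ring A] [Algebra ℂ A] [StarRing A]
    (x z : ℕ → A) (c : ℂ) (a b : ℕ → ℂ)
    (hx : ∀ k, x k * star (x k) = a k • (1 : A) + b k • z k)
    (hxz : ∀ k, x k * z (k + 1) = c • (z k * x k)) (n : ℕ) :
    ((List.range n).map x).prod * star ((List.range n).map x).prod =
      ((List.range n).map fun k => a k • (1 : A) + (b k * c ^ k) • z 0).prod := by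
  have hz : ∀ m, ((List.range m).map x).prod * z m =
      c ^ m • (z 0 * ((List.range m).map x).prod) := by
    intro m
    induction m with
    | zero => simp
    | succ m ih =>
      rw [List.prod_range_succ, mul_assoc, hxz, mul_smul_comm, ← mul_assoc, ih,
        smul_mul_assoc, smul_smul, pow_succ', mul_assoc]
  induction n with
  | zero => simp
  | succ n ih =>
    have hcomm : Commute (a n • (1 : A) + (b n * c ^ n) • z 0)
        ((List.range n).map fun k => a k • (1 : A) + (b k * c ^ k) • z 0).prod := by
      refine Commute.list_prod_right _ _ fun y hy => ?_
      obtain ⟨k, -, rfl⟩ := List.mem_map.mp hy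
      have h1 (e : ℂ) (y : A) : Commute (e • (1 : A)) y := (Commute.one_left y).smul_left e
      exact ((h1 _ _).add_left
        ((h1 _ _).symm.add_right (((Commute.refl (z 0)).smul_left _).smul_right _)))
    rw [List.prod_range_succ, List.prod_range_succ, ← hcomm.eq, ← ih, star_mul, ← mul_assoc,
      mul_assoc _ (x n), hx, mul_add, mul_smul_comm, mul_smul_comm, mul_one, hz, ← mul_assoc]
    congr 1
    rw [add_mul, smul_mul_assoc, one_mul, smul_mul_assoc, smul_smul]

/-- If `x * y = a + c * z'` and `y * x = a + d * z` with scalars `a`, `c`, `d`, then `x`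
intertwines `d • z` with `c • z'`. -/
lemma smul_mul_eq_smul_mul_of_mul_eq {A : Type*} [Ring A] [Algebra ℂ A] {x y z z' : A} {a c d : ℂ}
    (hxy : x * y = a • (1 : A) + c • z') (hyx : y * x = a • (1 : A) + d • z) :
    d • (x * z) = c • (z' * x) := by
  have h : x * y * x = x * (y * x) := mul_assoc _ _ _
  rw [hxy, hyx, add_mul, mul_add, smul_mul_assoc, one_mul, mul_smul_comm, mul_one,
    smul_mul_assoc, mul_smul_comm] at h
  exact (add_left_cancel h).symm

/-- Mapping over the monadic coercion of a list of naturals to a list of integers amounts to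
casting each entry. -/
lemma map_coe_list_int {B : Type*} (f : ℤ → B) (l : List ℕ) :
    List.map f (l : List ℤ) = l.map fun k : ℕ => f k := by
  induction l with
  | nil => rfl
  | cons a l ih => simpa using ih

/-- part of Lemma 2.4 of the paper.
With the `O(SU_q(2))` context as in statement 11 (`u' m = u_{−m}`, `w' m = w_{−m}`),
for every `n ≥ 1`:
`u_n u_n* = q^{−2n}(q²s²+ζ_s)(q⁴s²+ζ_s)⋯(q^{2n}s²+ζ_s)`,
`w_n w_n* = (1−ζ_s)(1−q²ζ_s)⋯(1−q^{2(n−1)}ζ_s)`,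
`u_{−n} u_{−n}* = (1−q^{−2}ζ_s)(1−q^{−4}ζ_s)⋯(1−q^{−2n}ζ_s)`  and
`w_{−n} w_{−n}* = (s²+ζ_s)(q^{−2}s²+ζ_s)⋯(q^{−2(n−1)}s²+ζ_s)`. -/
theorem stmt13
    (q s : ℝ) (hq0 : 0 < q) (hq1 : q < 1) (hs : 0 < s)
    {A : Type*} [Ring A] [Algebra ℂ A] [StarRing A] [StarModule ℂ A]
    (α β γ δ : A)
    (hαβ : α * β = (q : ℂ) • (β * α)) (hαγ : α * γ = (q : ℂ) • (γ * α))
    (hβδ : β * δ = (q : ℂ) • (δ * β)) (hγδ : γ * δ = (q : ℂ) • (δ * γ))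
    (hβγ : β * γ = γ * β)
    (hαδ : α * δ - (q : ℂ) • (β * γ) = 1)
    (hδα : δ * α - ((q : ℂ))⁻¹ • (β * γ) = 1)
    (hαst : star α = δ) (hβst : star β = -((q : ℂ) • γ))
    (hγst : star γ = -(((q : ℂ))⁻¹ • β)) (hδst : star δ = α)
    (ζ η : ℝ → A)
    (hζ : ∀ t : ℝ, ζ t = 1 - (α - ((q * t : ℝ) : ℂ) • γ) * (δ + ((t : ℝ) : ℂ) • β))
    (hη : ∀ t : ℝ, η t = (δ + ((q⁻¹ * t : ℝ) : ℂ) • β) * (β - ((t : ℝ) : ℂ) • δ))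
    (u w u' w' : ℕ → A)
    (hu : ∀ m : ℕ, u m =
      (((q : ℂ) ^ m)⁻¹) • ((List.range m).map fun k => β - ((q ^ (k + 1) * s : ℝ) : ℂ) • δ).prod)
    (hu' : ∀ m : ℕ, u' m =
      ((List.range m).map fun k => δ + ((q ^ (-(k + 1 : ℤ)) * s : ℝ) : ℂ) • β).prod)
    (hw : ∀ m : ℕ, w m =
      ((List.range m).map fun k => α - ((q ^ (k + 1) * s : ℝ) : ℂ) • γ).prod)
    (hw' : ∀ m : ℕ, w' m =
      ((((-q : ℝ) ^ m : ℝ)) : ℂ) • ((List.range m).map fun k => γ + ((q ^ (-(k + 1 : ℤ)) * s : ℝ) : ℂ) • α).prod)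
    (n : ℕ) (hn : 1 ≤ n)
    :
    u n * star (u n) = (((q : ℂ) ^ (2 * n))⁻¹) •
      ((List.range n).map fun k => ((q ^ (2 * (k + 1)) * s ^ 2 : ℝ) : ℂ) • (1 : A) + ζ s).prod ∧
    w n * star (w n) =
      ((List.range n).map fun k => 1 - ((q ^ (2 * k) : ℝ) : ℂ) • ζ s).prod ∧
    u' n * star (u' n) =
      ((List.range n).map fun k => 1 - ((q ^ (-(2 * (k + 1) : ℤ)) : ℝ) : ℂ) • ζ s).prod ∧
    w' n * star (w' n) =
      ((List.range n).map fun k => ((q ^ (-(2 * k : ℤ)) * s ^ 2 : ℝ) : ℂ) • (1 : A) + ζ s).prod := by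
  have hq : (q : ℂ) ≠ 0 := by exact_mod_cast hq0.ne'
  have hβα : β * α = (q : ℂ)⁻¹ • (α * β) := by rw [hαβ, inv_smul_smul₀ hq]
  have hδγ : δ * γ = (q : ℂ)⁻¹ • (γ * δ) := by rw [hγδ, inv_smul_smul₀ hq]
  have hαδ' : α * δ = 1 + (q : ℂ) • (β * γ) := sub_eq_iff_eq_add.mp hαδ
  have hδα' : δ * α = 1 + (q : ℂ)⁻¹ • (β * γ) := sub_eq_iff_eq_add.mp hδα
  have star_real (r : ℝ) (x : A) : star ((r : ℂ) • x) = (r : ℂ) • star x := by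
    rw [star_smul, Complex.star_def, Complex.conj_ofReal]
  have hbst (t : ℝ) : star (β - (t : ℂ) • δ) = -((q : ℂ) • γ) - (t : ℂ) • α := by
    rw [star_sub, star_real, hβst, hδst]
  have hast (t : ℝ) : star (α - (t : ℂ) • γ) = δ + ((q⁻¹ * t : ℝ) : ℂ) • β := by
    rw [star_sub, star_real, hαst, hγst]
    push_cast
    module
  have hdst (t : ℝ) : star (δ + (t : ℂ) • β) = α - ((q * t : ℝ) : ℂ) • γ := by
    rw [star_add, star_real, hδst, hβst]
    push_cast
    module
  have hest (t : ℝ) : star (((-q : ℝ) : ℂ) • (γ + (t : ℂ) • α)) = β - ((q * t : ℝ) : ℂ) • δ := by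
    rw [star_real, star_add, star_real, hγst, hαst]
    push_cast
    match_scalars <;> field_simp
  have hbb (t : ℝ) : (β - ((q * t : ℝ) : ℂ) • δ) * (-((q : ℂ) • γ) - ((q * t : ℝ) : ℂ) • α) =
      ((q ^ 2 * t ^ 2 : ℝ) : ℂ) • (1 : A) + (1 : ℂ) • ζ t := by
    rw [hζ]
    simp only [mul_add, mul_sub, sub_mul, mul_neg, smul_mul_assoc,
      mul_smul_comm, hβα, hδγ, ← hβγ, hαδ', hδα']
    push_cast
    match_scalars <;> field_simp <;> ring
  have hbb' (t : ℝ) : (-((q : ℂ) • γ) - (t : ℂ) • α) * (β - (t : ℂ) • δ) =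
      ((t ^ 2 : ℝ) : ℂ) • (1 : A) + (1 : ℂ) • ζ t := by
    rw [hζ]
    simp only [mul_add, mul_sub, sub_mul, neg_mul, smul_mul_assoc, mul_smul_comm, ← hβγ, hαδ']
    push_cast
    match_scalars <;> field_simp <;> ring
  have had (t : ℝ) : (α - ((q * t : ℝ) : ℂ) • γ) * (δ + (t : ℂ) • β) =
      (1 : ℂ) • (1 : A) + (-1 : ℂ) • ζ t := by
    rw [hζ]
    module
  have hda (t : ℝ) : (δ + ((q⁻¹ * t : ℝ) : ℂ) • β) * (α - (t : ℂ) • γ) =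
      (1 : ℂ) • (1 : A) + (-((q : ℂ) ^ 2)⁻¹) • ζ t := by
    rw [hζ]
    simp only [mul_add, add_mul, mul_sub, sub_mul, smul_mul_assoc,
      mul_smul_comm, hβα, hδγ, ← hβγ, hαδ', hδα']
    push_cast
    match_scalars <;> field_simp <;> ring
  have hqt (t : ℝ) : q⁻¹ * (q * t) = t := inv_mul_cancel_left₀ hq0.ne' t
  have hbζ (t : ℝ) : (β - ((q * t : ℝ) : ℂ) • δ) * ζ (q * t) =
      (1 : ℂ) • (ζ t * (β - ((q * t : ℝ) : ℂ) • δ)) := by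
    have h := hbb' (q * t)
    rw [mul_pow] at h
    simpa only [one_smul] using smul_mul_eq_smul_mul_of_mul_eq (hbb t) h
  have hbstζ (t : ℝ) : (-((q : ℂ) • γ) - ((q * t : ℝ) : ℂ) • α) * ζ t =
      (1 : ℂ) • (ζ (q * t) * (-((q : ℂ) • γ) - ((q * t : ℝ) : ℂ) • α)) := by
    have h := hbb' (q * t)
    rw [mul_pow] at h
    simpa only [one_smul] using smul_mul_eq_smul_mul_of_mul_eq h (hbb t)
  have hda' (t : ℝ) : (δ + (t : ℂ) • β) * (α - ((q * t : ℝ) : ℂ) • γ) =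
      (1 : ℂ) • (1 : A) + (-((q : ℂ) ^ 2)⁻¹) • ζ (q * t) := by
    rw [← hda, hqt]
  have haζ (t : ℝ) : (α - ((q * t : ℝ) : ℂ) • γ) * ζ (q * t) =
      (q : ℂ) ^ 2 • (ζ t * (α - ((q * t : ℝ) : ℂ) • γ)) := by
    have h := smul_mul_eq_smul_mul_of_mul_eq (had t) (hda' t)
    rw [neg_smul, neg_smul, one_smul, neg_inj] at h
    rw [← h, smul_inv_smul₀ (pow_ne_zero 2 hq)]
  have hdζ (t : ℝ) : (δ + (t : ℂ) • β) * ζ t =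
      ((q : ℂ) ^ 2)⁻¹ • (ζ (q * t) * (δ + (t : ℂ) • β)) := by
    have h := smul_mul_eq_smul_mul_of_mul_eq (hda' t) (had t)
    rwa [neg_smul, neg_smul, one_smul, neg_inj] at h
  have hpos (k : ℕ) : q ^ (k + 1) * s = q * (q ^ k * s) := by ring
  have hneg (k : ℕ) : q * (q ^ (-(k + 1 : ℤ)) * s) = q ^ (-(k : ℤ)) * s := by
    rw [← mul_assoc, ← zpow_one_add₀ hq0.ne']
    congr 2
    ring
  have hneg' (k : ℕ) : q ^ (-((k + 1 : ℕ) : ℤ)) * s = q ^ (-(k + 1 : ℤ)) * s := by push_cast; rfl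
  simp only [map_coe_list_int] at hu' hw' ⊢
  refine ⟨?_, ?_, ?_, ?_⟩
  · have h := prod_range_mul_star_of_intertwine
      (fun k => β - ((q ^ (k + 1) * s : ℝ) : ℂ) • δ) (fun k : ℕ => ζ (q ^ k * s)) 1
      (fun k => ((q ^ 2 * (q ^ k * s) ^ 2 : ℝ) : ℂ)) (fun _ => 1)
      (fun k => by simp only [hbst, hpos, hbb])
      (fun k => by simp only [hpos, hbζ]) n
    have hstar : star (((q : ℂ) ^ n)⁻¹) = ((q : ℂ) ^ n)⁻¹ := by
      rw [star_inv₀, star_pow, Complex.star_def, Complex.conj_ofReal]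
    rw [hu, star_smul, hstar, smul_mul_assoc, mul_smul_comm, smul_smul, h, ← mul_inv, ← pow_add,
      ← two_mul]
    congr 2
    refine List.map_congr_left fun k _ => ?_
    simp only [one_pow, mul_one, one_smul, pow_zero, one_mul]
    congr 3
    ring
  · rw [hw, prod_range_mul_star_of_intertwine
      (fun k => α - ((q ^ (k + 1) * s : ℝ) : ℂ) • γ) (fun k : ℕ => ζ (q ^ k * s)) ((q : ℂ) ^ 2)
      (fun _ => 1) (fun _ => -1)
      (fun k => by simp only [hast, hpos, hqt, had])
      (fun k => by simp only [hpos, haζ])]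
    congr 1
    refine List.map_congr_left fun k _ => ?_
    simp only [pow_zero, one_mul, ← pow_mul]
    push_cast
    module
  · rw [hu', prod_range_mul_star_of_intertwine
      (fun k : ℕ => δ + ((q ^ (-(k + 1 : ℤ)) * s : ℝ) : ℂ) • β) (fun k : ℕ => ζ (q ^ (-(k : ℤ)) * s))
      ((q : ℂ) ^ 2)⁻¹ (fun _ => 1) (fun _ => -((q : ℂ) ^ 2)⁻¹)
      (fun k => by rw [hdst, hda', hneg])
      (fun k => by simp only [hneg', hdζ, hneg])]
    congr 1
    refine List.map_congr_left fun k _ => ?_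
    have hpow : (q : ℂ) ^ (-(2 * (k + 1) : ℤ)) = ((q : ℂ) ^ 2)⁻¹ * (((q : ℂ) ^ 2)⁻¹) ^ k := by
      rw [← pow_succ', zpow_neg, inv_pow, ← pow_mul]
      norm_cast
    push_cast
    rw [hpow]
    simp only [neg_zero, zpow_zero, one_mul]
    module
  · have he (t : ℝ) : ((-q : ℝ) : ℂ) • (γ + (t : ℂ) • α) =
        -((q : ℂ) • γ) - ((q * t : ℝ) : ℂ) • α := by
      push_cast
      module
    have hpull : w' n = ((List.range n).map fun k : ℕ =>
        ((-q : ℝ) : ℂ) • (γ + ((q ^ (-(k + 1 : ℤ)) * s : ℝ) : ℂ) • α)).prod := by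
      rw [hw']
      clear hn
      induction n with
      | zero => simp
      | succ n ih =>
        rw [List.prod_range_succ, List.prod_range_succ, ← ih, mul_smul_comm, smul_mul_assoc,
          smul_smul]
        push_cast
        rw [pow_succ']
    rw [hpull, prod_range_mul_star_of_intertwine
      (fun k : ℕ => ((-q : ℝ) : ℂ) • (γ + ((q ^ (-(k + 1 : ℤ)) * s : ℝ) : ℂ) • α))
      (fun k : ℕ => ζ (q ^ (-(k : ℤ)) * s)) 1
      (fun k : ℕ => (((q * (q ^ (-(k + 1 : ℤ)) * s)) ^ 2 : ℝ) : ℂ)) (fun _ => 1)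
      (fun k => by rw [hest, he, hbb', hneg])
      (fun k => by rw [hneg', he, hbstζ, hneg])]
    congr 1
    refine List.map_congr_left fun k _ => ?_
    simp only [one_pow, mul_one, one_smul, Nat.cast_zero, neg_zero, zpow_zero, one_mul, hneg]
    congr 3
    rw [mul_pow, ← zpow_natCast, ← zpow_mul]
    congr 2
    push_cast
    ring
end

section
/- The elements η_s and ζ_s of A satisfy the defining relations of the Podleś sphere O(S²_{qs}): ζ_s is hermitian (ζ_s* = ζ_s), ζ_s·η_s = q²·η_s·ζ_s, η_s*·η_s = (1 − ζ_s)(s² + ζ_s), and η_s·η_s* = (1 − q^{−2}ζ_s)(s² + q^{−2}ζ_s). -/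
/-- With `α, β, γ, δ` generators of `O(SU_q(2))` inside a complex star-algebra `A`, the elements
`ζ_s := 1 − (α − qsγ)(δ + sβ)` and `η_s := (δ + q⁻¹sβ)(β − sδ)` satisfy the defining
relations of the Podleś sphere `O(S²_{qs})`:  `ζ_s* = ζ_s`,  `ζ_s η_s = q² η_s ζ_s`,
`η_s* η_s = (1 − ζ_s)(s² + ζ_s)`  and  `η_s η_s* = (1 − q^{−2}ζ_s)(s² + q^{−2}ζ_s)`. -/
theorem stmt14
    (q s : ℝ) (hq0 : 0 < q) (hq1 : q < 1) (hs : 0 < s)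
    {A : Type*} [Ring A] [Algebra ℂ A] [StarRing A] [StarModule ℂ A]
    (α β γ δ : A)
    (hαβ : α * β = (q : ℂ) • (β * α)) (hαγ : α * γ = (q : ℂ) • (γ * α))
    (hβδ : β * δ = (q : ℂ) • (δ * β)) (hγδ : γ * δ = (q : ℂ) • (δ * γ))
    (hβγ : β * γ = γ * β)
    (hαδ : α * δ - (q : ℂ) • (β * γ) = 1)
    (hδα : δ * α - ((q : ℂ))⁻¹ • (β * γ) = 1)
    (hαst : star α = δ) (hβst : star β = -((q : ℂ) • γ))
    (hγst : star γ = -(((q : ℂ))⁻¹ • β)) (hδst : star δ = α)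
    (ζs ηs : A)
    (hζs : ζs = 1 - (α - ((q * s : ℝ) : ℂ) • γ) * (δ + ((s : ℝ) : ℂ) • β))
    (hηs : ηs = (δ + ((q⁻¹ * s : ℝ) : ℂ) • β) * (β - ((s : ℝ) : ℂ) • δ)) :
    star ζs = ζs ∧
    ζs * ηs = ((q : ℂ) ^ 2) • (ηs * ζs) ∧
    star ηs * ηs = (1 - ζs) * (((s ^ 2 : ℝ) : ℂ) • (1 : A) + ζs) ∧
    ηs * star ηs = (1 - ((q ^ (-2 : ℤ) : ℝ) : ℂ) • ζs) *
      (((s ^ 2 : ℝ) : ℂ) • (1 : A) + ((q ^ (-2 : ℤ) : ℝ) : ℂ) • ζs) := by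
  have hq : (q : ℂ) ≠ 0 := by exact_mod_cast hq0.ne'
  have hβα : β * α = (q : ℂ)⁻¹ • (α * β) := by rw [hαβ, inv_smul_smul₀ hq]
  have hγα : γ * α = (q : ℂ)⁻¹ • (α * γ) := by rw [hαγ, inv_smul_smul₀ hq]
  have hαδ' : α * δ = 1 + (q : ℂ) • (β * γ) := sub_eq_iff_eq_add.mp hαδ
  have hδα' : δ * α = 1 + (q : ℂ)⁻¹ • (β * γ) := sub_eq_iff_eq_add.mp hδα
  have hβα_mul (x : A) : β * (α * x) = (q : ℂ)⁻¹ • (α * (β * x)) := by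
    rw [← mul_assoc, hβα, smul_mul_assoc, mul_assoc]
  have hγα_mul (x : A) : γ * (α * x) = (q : ℂ)⁻¹ • (α * (γ * x)) := by
    rw [← mul_assoc, hγα, smul_mul_assoc, mul_assoc]
  have hβδ_mul (x : A) : β * (δ * x) = (q : ℂ) • (δ * (β * x)) := by
    rw [← mul_assoc, hβδ, smul_mul_assoc, mul_assoc]
  have hγδ_mul (x : A) : γ * (δ * x) = (q : ℂ) • (δ * (γ * x)) := by
    rw [← mul_assoc, hγδ, smul_mul_assoc, mul_assoc]
  have hγβ_mul (x : A) : γ * (β * x) = β * (γ * x) := by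
    rw [← mul_assoc, ← hβγ, mul_assoc]
  have hαδ_mul (x : A) : α * (δ * x) = x + (q : ℂ) • (β * (γ * x)) := by
    rw [← mul_assoc, hαδ', add_mul, one_mul, smul_mul_assoc, mul_assoc]
  have hδα_mul (x : A) : δ * (α * x) = x + (q : ℂ)⁻¹ • (β * (γ * x)) := by
    rw [← mul_assoc, hδα', add_mul, one_mul, smul_mul_assoc, mul_assoc]
  have hη_star : star ηs =
      (-((q : ℂ) • γ) - (s : ℂ) • α) * (α - (s : ℂ) • γ) := by
    rw [hηs]
    simp only [star_mul, star_add, star_sub, star_smul, hβst, hδst, RCLike.star_def,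
      Complex.conj_ofReal]
    congr 1
    push_cast
    match_scalars <;> field_simp
  refine ⟨?_, ?_, ?_, ?_⟩
  · rw [hζs]
    simp only [star_one, star_mul, star_add, star_sub, star_smul, hαst, hβst, hγst, hδst,
      RCLike.star_def, Complex.conj_ofReal]
    congr 2
    · push_cast
      module
    · push_cast
      match_scalars <;> field_simp
  · rw [hζs, hηs]
    simp only [Complex.ofReal_mul, Complex.ofReal_inv,
      mul_add, add_mul, mul_sub, sub_mul,
      smul_mul_assoc, mul_smul_comm, smul_add, smul_sub, mul_one, one_mul,
      mul_assoc, hβδ, hγδ, ← hβγ, hαδ', hβα_mul, hβδ_mul, hγδ_mul,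
      hγβ_mul, hαδ_mul, hδα_mul]
    match_scalars <;> field_simp <;> ring
  · rw [hη_star]
    rw [hζs, hηs]
    simp only [Complex.ofReal_mul, Complex.ofReal_inv, Complex.ofReal_pow,
      mul_add, add_mul, mul_sub, sub_mul,
      smul_mul_assoc, mul_smul_comm, smul_add, smul_sub, smul_neg, neg_mul, mul_one, one_mul,
      mul_assoc, hγα, hβδ, hγδ, ← hβγ, hαδ', hβα_mul, hγα_mul, hβδ_mul, hγδ_mul,
      hγβ_mul, hαδ_mul, hδα_mul]
    match_scalars <;> field_simp <;> ring
  · rw [hη_star]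
    rw [hζs, hηs]
    simp only [Complex.ofReal_mul, Complex.ofReal_inv, Complex.ofReal_pow,
      zpow_neg, zpow_ofNat, mul_add, add_mul, mul_sub, sub_mul,
      smul_mul_assoc, mul_smul_comm, smul_add, smul_sub, smul_neg, neg_mul, mul_neg, mul_one, one_mul,
      mul_assoc, hβα, hγα, hβδ, hγδ, ← hβγ, hαδ', hδα', hβα_mul, hγα_mul, hβδ_mul, hγδ_mul,
      hγβ_mul, hαδ_mul, hδα_mul]
    match_scalars <;> field_simp <;> ring
end

section
/- The operators Z₊ and H₊ on ℓ²(ℕ₀) satisfy the defining relations of the Podleś sphere O(S²_{qs}): Z₊ is self-adjoint, Z₊H₊ = q²·H₊Z₊, H₊*H₊ = (1 − Z₊)(s²·1 + Z₊), and H₊H₊* = (1 − q^{−2}Z₊)(s²·1 + q^{−2}Z₊). (That is, the formulas define a bounded *-representation ρ₊ of O(S²_{qs}).) -/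
set_option synthInstance.maxHeartbeats 1000000
set_option maxHeartbeats 1000000

/-- Two vectors with the same inner products against a total family are equal. -/
theorem eq_of_inner_total_family {ι H : Type*} [NormedAddCommGroup H] [InnerProductSpace ℂ H]
    {e : ι → H} (hd : Dense (Submodule.span ℂ (Set.range e) : Set H)) {x y : H}
    (h : ∀ n, inner ℂ (e n) x = inner ℂ (e n) y) : x = y := by
  have key : innerSL ℂ x = innerSL ℂ y := by
    refine ContinuousLinearMap.ext_on hd ?_
    rintro _ ⟨n, rfl⟩
    simpa using congrArg (starRingEnd ℂ) (h n)
  exact (innerSL_inj (𝕜 := ℂ)).1 key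

/-- The adjoint of an operator which is diagonal with real entries in a total orthonormal family
acts in the same way on that family. -/
theorem star_diagonal_apply {H : Type*} [NormedAddCommGroup H] [InnerProductSpace ℂ H]
    [CompleteSpace H] {e : ℕ → H} (he : Orthonormal ℂ e)
    (hd : Dense (Submodule.span ℂ (Set.range e) : Set H)) {T : H →L[ℂ] H} {a : ℕ → ℝ}
    (hT : ∀ m, T (e m) = (a m : ℂ) • e m) (m : ℕ) : star T (e m) = (a m : ℂ) • e m := by
  refine eq_of_inner_total_family hd fun n => ?_
  rw [ContinuousLinearMap.star_eq_adjoint, ContinuousLinearMap.adjoint_inner_right, hT,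
    inner_smul_left, inner_smul_right, orthonormal_iff_ite.1 he, Complex.conj_ofReal]
  split_ifs with h
  · rw [h]
  · simp

/-- The adjoint of a weighted shift kills the first basis vector. -/
theorem star_weightedShift_apply_zero {H : Type*} [NormedAddCommGroup H] [InnerProductSpace ℂ H]
    [CompleteSpace H] {e : ℕ → H} (he : Orthonormal ℂ e)
    (hd : Dense (Submodule.span ℂ (Set.range e) : Set H)) {T : H →L[ℂ] H} {c : ℕ → ℝ}
    (hT : ∀ m, T (e m) = (c m : ℂ) • e (m + 1)) : star T (e 0) = 0 := by
  refine eq_of_inner_total_family hd fun n => ?_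
  rw [ContinuousLinearMap.star_eq_adjoint, ContinuousLinearMap.adjoint_inner_right, hT,
    inner_smul_left, orthonormal_iff_ite.1 he]
  simp

/-- The adjoint of a weighted shift with real weights is the backward shift with the same
weights. -/
theorem star_weightedShift_apply_succ {H : Type*} [NormedAddCommGroup H] [InnerProductSpace ℂ H]
    [CompleteSpace H] {e : ℕ → H} (he : Orthonormal ℂ e)
    (hd : Dense (Submodule.span ℂ (Set.range e) : Set H)) {T : H →L[ℂ] H} {c : ℕ → ℝ}
    (hT : ∀ m, T (e m) = (c m : ℂ) • e (m + 1)) (m : ℕ) :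
    star T (e (m + 1)) = (c m : ℂ) • e m := by
  refine eq_of_inner_total_family hd fun n => ?_
  rw [ContinuousLinearMap.star_eq_adjoint, ContinuousLinearMap.adjoint_inner_right, hT,
    inner_smul_left, inner_smul_right, orthonormal_iff_ite.1 he, orthonormal_iff_ite.1 he,
    Complex.conj_ofReal]
  by_cases h : n = m
  · simp [h]
  · simp [h]

/-- On `ℓ²(ℕ₀)` (a complex Hilbert space with total orthonormal family `e`), the operators
`Z₊ e_m = q^{2(m+1)} e_m` and `H₊ e_m = √((1−q^{2(m+1)})(s²+q^{2(m+1)})) e_{m+1}` satisfy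
the defining relations of the Podleś sphere `O(S²_{qs})`:  `Z₊` is self-adjoint,
`Z₊H₊ = q² H₊Z₊`, `H₊*H₊ = (1 − Z₊)(s² + Z₊)` and `H₊H₊* = (1 − q^{−2}Z₊)(s² + q^{−2}Z₊)`;
that is, the formulas define a bounded *-representation `ρ₊` of `O(S²_{qs})`. -/
theorem stmt15
    (q s : ℝ) (hq0 : 0 < q) (hq1 : q < 1) (hs : 0 < s)
    {H : Type*} [NormedAddCommGroup H] [InnerProductSpace ℂ H] [CompleteSpace H]
    (e : ℕ → H) (he : Orthonormal ℂ e)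
    (htotal : (Submodule.span ℂ (Set.range e)).topologicalClosure = ⊤)
    (Zp Hp : H →L[ℂ] H)
    (hZp : ∀ m : ℕ, Zp (e m) = ((q ^ (2 * (m + 1)) : ℝ) : ℂ) • e m)
    (hHp : ∀ m : ℕ, Hp (e m) =
      ((Real.sqrt ((1 - q ^ (2 * (m + 1))) * (s ^ 2 + q ^ (2 * (m + 1)))) : ℝ) : ℂ) • e (m + 1))
    :
    star Zp = Zp ∧
    Zp * Hp = ((q : ℂ) ^ 2) • (Hp * Zp) ∧
    star Hp * Hp = (1 - Zp) * (((s ^ 2 : ℝ) : ℂ) • (1 : H →L[ℂ] H) + Zp) ∧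
    Hp * star Hp = (1 - ((q ^ (-2 : ℤ) : ℝ) : ℂ) • Zp) *
      (((s ^ 2 : ℝ) : ℂ) • (1 : H →L[ℂ] H) + ((q ^ (-2 : ℤ) : ℝ) : ℂ) • Zp) := by
  have hd : Dense (Submodule.span ℂ (Set.range e) : Set H) :=
    Submodule.dense_iff_topologicalClosure_eq_top.2 htotal
  have ext_e : ∀ {A B : H →L[ℂ] H}, (∀ m, A (e m) = B (e m)) → A = B := fun h =>
    ContinuousLinearMap.ext_on hd (by rintro _ ⟨m, rfl⟩; exact h m)
  have hq : (q : ℂ) ≠ 0 := by exact_mod_cast hq0.ne'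
  have hweight : ∀ m : ℕ,
      ((√((1 - q ^ (2 * (m + 1))) * (s ^ 2 + q ^ (2 * (m + 1)))) : ℝ) : ℂ) *
        ((√((1 - q ^ (2 * (m + 1))) * (s ^ 2 + q ^ (2 * (m + 1)))) : ℝ) : ℂ) =
      (1 - (q : ℂ) ^ (2 * (m + 1))) * ((s : ℂ) ^ 2 + (q : ℂ) ^ (2 * (m + 1))) := by
    intro m
    have h1 : q ^ (2 * (m + 1)) ≤ 1 := pow_le_one₀ hq0.le hq1.le
    have h2 : 0 ≤ (1 - q ^ (2 * (m + 1))) * (s ^ 2 + q ^ (2 * (m + 1))) :=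
      mul_nonneg (sub_nonneg.2 h1) (by positivity)
    rw [← Complex.ofReal_mul, Real.mul_self_sqrt h2]
    push_cast
    rfl
  have hS0 := star_weightedShift_apply_zero he hd hHp
  have hS := star_weightedShift_apply_succ he hd hHp
  refine ⟨ext_e fun m => ?_, ext_e fun m => ?_, ext_e fun m => ?_, ext_e fun m => ?_⟩
  · rw [star_diagonal_apply he hd hZp, hZp]
  · simp only [mul_apply_eq_comp, smul_apply, hZp, hHp, map_smul,
      smul_smul]
    congr 1
    push_cast
    ring
  · simp only [mul_apply_eq_comp, smul_apply,
      add_apply, sub_apply,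
      one_apply_eq_self, hZp, hHp, hS, map_smul, smul_smul, hweight, ← add_smul]
    push_cast
    module
  · cases m with
    | zero =>
      simp only [mul_apply_eq_comp, smul_apply,
        add_apply, sub_apply,
        one_apply_eq_self, hZp, hS0, map_zero, map_smul, smul_smul, ← add_smul]
      have hcancel : (q : ℂ) ^ (-2 : ℤ) * (q : ℂ) ^ (2 * (0 + 1)) = 1 := by
        rw [zpow_neg]
        exact inv_mul_cancel₀ (pow_ne_zero 2 hq)
      push_cast
      rw [hcancel]
      module
    | succ m =>
      simp only [mul_apply_eq_comp, smul_apply,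
        add_apply, sub_apply,
        one_apply_eq_self, hZp, hHp, hS, map_smul, smul_smul, hweight, ← add_smul]
      have hshift : (q : ℂ) ^ (-2 : ℤ) * (q : ℂ) ^ (2 * (m + 1 + 1)) = (q : ℂ) ^ (2 * (m + 1)) := by
        rw [zpow_neg]
        field_simp
        norm_cast
        ring
      push_cast
      rw [hshift]
      module
end

section
/- The operator 1 − Z₋ on ℓ²(ℕ₀) is positive and invertible, and the operator z₋ := s^{−1}·H₋·(1 − Z₋)^{−1/2} (with the inverse square root given by the continuous functional calculus) satisfies the defining relation of the quantum disc, z₋*z₋ − q²·z₋z₋* = (1 − q²)·1, and moreover Z₋ = (q^{−2} − 1)^{−1}·s²·(z₋z₋* − z₋*z₋). -/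
set_option synthInstance.maxHeartbeats 1000000
set_option maxHeartbeats 1000000

section DenseOrthonormal

variable {H : Type*} [NormedAddCommGroup H] [InnerProductSpace ℂ H]

/-- Two vectors with the same inner products against a total family are equal. -/
theorem eq_of_forall_inner_left_of_total {e : ℕ → H}
    (htotal : (Submodule.span ℂ (Set.range e)).topologicalClosure = ⊤) {x y : H}
    (h : ∀ n, inner ℂ (e n) x = inner ℂ (e n) y) : x = y := by
  refine (Submodule.dense_iff_topologicalClosure_eq_top.mpr htotal).eq_of_inner_right ℂ ?_
  intro v hv
  induction hv using Submodule.span_induction with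
  | mem v hv => obtain ⟨n, rfl⟩ := hv; exact h n
  | zero => simp
  | add u v _ _ hu hv => simp [inner_add_left, hu, hv]
  | smul c v _ hv => simp [inner_smul_left, hv]

/-- An eigenvector of the square of a positive operator `R` with eigenvalue `r ^ 2`, `r > 0`, is an
eigenvector of `R` with eigenvalue `r`. -/
theorem ContinuousLinearMap.apply_eq_smul_of_sq {R : H →L[ℂ] H} (hR : 0 ≤ R) {r : ℝ} (hr : 0 < r)
    {v : H} (hv : R (R v) = ((r ^ 2 : ℝ) : ℂ) • v) : R v = (r : ℂ) • v := by
  set u := R v - (r : ℂ) • v with hu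
  have hRu : R u = -((r : ℂ) • u) := by
    rw [hu, map_sub, map_smul, hv]
    push_cast
    module
  have hpos := ((ContinuousLinearMap.nonneg_iff_isPositive R).mp hR).re_inner_nonneg_right u
  rw [hRu, inner_neg_right, inner_smul_right, inner_self_eq_norm_sq_to_K] at hpos
  have h : 0 ≤ -(r * ‖u‖ ^ 2) := by
    convert! hpos using 1
    simp [← Complex.ofReal_pow]
  have h0 : ‖u‖ ^ 2 = 0 := le_antisymm (by nlinarith [sq_nonneg ‖u‖]) (sq_nonneg _)
  exact sub_eq_zero.mp (norm_eq_zero.mp (pow_eq_zero_iff two_ne_zero |>.mp h0))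

variable [CompleteSpace H]

/-- An operator that is diagonal with nonnegative entries in a total orthonormal family is
positive. -/
theorem ContinuousLinearMap.nonneg_of_apply_eq_smul {e : ℕ → H} (he : Orthonormal ℂ e)
    (htotal : (Submodule.span ℂ (Set.range e)).topologicalClosure = ⊤)
    {W : H →L[ℂ] H} {w : ℕ → ℝ} (hw : ∀ n, 0 ≤ w n) (hW : ∀ n, W (e n) = (w n : ℂ) • e n) :
    0 ≤ W := by
  rw [ContinuousLinearMap.nonneg_iff_isPositive, ContinuousLinearMap.isPositive_iff_complex]
  intro x
  let b := HilbertBasis.mk he htotal.ge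
  have hbe : ⇑b = e := HilbertBasis.coe_mk he htotal.ge
  have hsum : HasSum (fun n => ((w n * ‖inner ℂ (e n) x‖ ^ 2 : ℝ) : ℂ)) (inner ℂ (W x) x) := by
    have := ((b.hasSum_repr x).mapL ((innerSL ℂ x) ∘L W)).star
    convert! this using 1
    · ext n
      rw [b.repr_apply_apply, hbe]
      simp only [map_smul, ContinuousLinearMap.comp_apply, hW, innerSL_apply_apply, smul_eq_mul,
        star_mul', RCLike.star_def, inner_conj_symm, Complex.conj_ofReal]
      rw [← inner_conj_symm x (e n)]
      have := Complex.mul_conj' (inner ℂ (e n) x)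
      push_cast
      rw [← this, inner_conj_symm]
      ring
    · simp
  have hre := Complex.hasSum_re hsum
  have him := Complex.hasSum_im hsum
  simp only [Complex.ofReal_re, Complex.ofReal_im] at hre him
  have him0 := him.unique hasSum_zero
  refine ⟨Complex.ext (by simp) (by simpa using him0.symm), ?_⟩
  exact hre.nonneg fun n => mul_nonneg (hw n) (sq_nonneg _)

/-- The adjoint of a weighted shift kills the initial basis vector. -/
theorem star_apply_zero_of_weighted_shift {e : ℕ → H} (he : Orthonormal ℂ e)
    (htotal : (Submodule.span ℂ (Set.range e)).topologicalClosure = ⊤)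
    {z : H →L[ℂ] H} {c : ℕ → ℝ} (hz : ∀ n, z (e n) = (c n : ℂ) • e (n + 1)) :
    star z (e 0) = 0 := by
  refine eq_of_forall_inner_left_of_total htotal fun n => ?_
  rw [ContinuousLinearMap.star_eq_adjoint, ContinuousLinearMap.adjoint_inner_right, hz,
    inner_smul_left, he.2 n.succ_ne_zero]
  simp

/-- The adjoint of a weighted shift is the backward shift with the same real weights. -/
theorem star_apply_succ_of_weighted_shift {e : ℕ → H} (he : Orthonormal ℂ e)
    (htotal : (Submodule.span ℂ (Set.range e)).topologicalClosure = ⊤)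
    {z : H →L[ℂ] H} {c : ℕ → ℝ} (hz : ∀ n, z (e n) = (c n : ℂ) • e (n + 1)) (m : ℕ) :
    star z (e (m + 1)) = (c m : ℂ) • e m := by
  refine eq_of_forall_inner_left_of_total htotal fun n => ?_
  rw [ContinuousLinearMap.star_eq_adjoint, ContinuousLinearMap.adjoint_inner_right, hz,
    inner_smul_left, inner_smul_right, orthonormal_iff_ite.mp he, orthonormal_iff_ite.mp he]
  by_cases h : n = m
  · simp [h]
  · simp [h]

end DenseOrthonormal

set_option maxHeartbeats 1000000

/-- On `ℓ²(ℕ₀)`, with `Z₋, H₋` as in statement 16, the operator `1 − Z₋` is positive and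
invertible, and `z₋ := s⁻¹·H₋·(1 − Z₋)^{−1/2}` (the inverse square root being given by the
continuous functional calculus, here `CFC.sqrt` of the inverse) satisfies the quantum disc
relation `z₋*z₋ − q² z₋z₋* = (1 − q²)·1`, and `Z₋ = (q^{−2} − 1)^{−1} s² (z₋z₋* − z₋*z₋)`. -/
theorem stmt19
    (q s : ℝ) (hq0 : 0 < q) (hq1 : q < 1) (hs : 0 < s)
    {H : Type*} [NormedAddCommGroup H] [InnerProductSpace ℂ H] [CompleteSpace H]
    (e : ℕ → H) (he : Orthonormal ℂ e)
    (htotal : (Submodule.span ℂ (Set.range e)).topologicalClosure = ⊤)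
    (Zm Hm : H →L[ℂ] H)
    (hZm : ∀ m : ℕ, Zm (e m) = ((-(s ^ 2 * q ^ (2 * (m + 1))) : ℝ) : ℂ) • e m)
    (hHm : ∀ m : ℕ, Hm (e m) =
      ((s * Real.sqrt ((1 + s ^ 2 * q ^ (2 * (m + 1))) * (1 - q ^ (2 * (m + 1)))) : ℝ) : ℂ) • e (m + 1))
    (z : H →L[ℂ] H)
    (hz : z = ((s⁻¹ : ℝ) : ℂ) • (Hm * CFC.sqrt (Ring.inverse ((1 : H →L[ℂ] H) - Zm)))) :
    0 ≤ (1 : H →L[ℂ] H) - Zm ∧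
    IsUnit ((1 : H →L[ℂ] H) - Zm) ∧
    star z * z - ((q : ℂ) ^ 2) • (z * star z) = ((1 - q ^ 2 : ℝ) : ℂ) • (1 : H →L[ℂ] H) ∧
    Zm = ((((q ^ (-2 : ℤ) - 1 : ℝ)⁻¹ * s ^ 2 : ℝ)) : ℂ) • (z * star z - star z * z) := by
  have hext : ∀ A B : H →L[ℂ] H, (∀ n, A (e n) = B (e n)) → A = B := fun A B h =>
    ContinuousLinearMap.ext_on (Submodule.dense_iff_topologicalClosure_eq_top.mpr htotal)
      (by rintro _ ⟨n, rfl⟩; exact h n)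
  have hone : (1 : H →L[ℂ] H) ≤ 1 - Zm := by
    rw [sub_eq_add_neg, le_add_iff_nonneg_right]
    refine ContinuousLinearMap.nonneg_of_apply_eq_smul he htotal
      (w := fun n => s ^ 2 * q ^ (2 * (n + 1))) (fun n => by positivity) fun n => ?_
    simp [hZm]
  have hpos : 0 ≤ (1 : H →L[ℂ] H) - Zm := zero_le_one.trans hone
  have hunit : IsUnit ((1 : H →L[ℂ] H) - Zm) :=
    CStarAlgebra.isUnit_of_le 1 hone (IsUnit.isStrictlyPositive isUnit_one zero_le_one)
  refine ⟨hpos, hunit, ?_⟩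
  set a : ℕ → ℝ := fun n => 1 + s ^ 2 * q ^ (2 * (n + 1)) with ha
  have ha0 : ∀ n, 0 < a n := fun n => by simp only [ha]; positivity
  have hA : ∀ n, ((1 : H →L[ℂ] H) - Zm) (e n) = (a n : ℂ) • e n := fun n => by
    simp only [ha, sub_apply, one_apply_eq_self, hZm]
    push_cast
    module
  set R := CFC.sqrt (Ring.inverse ((1 : H →L[ℂ] H) - Zm)) with hR
  have hinv : ∀ n, Ring.inverse ((1 : H →L[ℂ] H) - Zm) (e n) = ((a n)⁻¹ : ℂ) • e n := fun n => by
    have h := congrArg (fun T : H →L[ℂ] H => T (e n)) (Ring.inverse_mul_cancel _ hunit)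
    simp only [mul_apply_eq_comp, hA, map_smul, one_apply_eq_self] at h
    rw [eq_inv_smul_iff₀ (Complex.ofReal_ne_zero.mpr (ha0 n).ne'), h]
  have hinv0 : 0 ≤ Ring.inverse ((1 : H →L[ℂ] H) - Zm) :=
    ContinuousLinearMap.nonneg_of_apply_eq_smul he htotal (w := fun n => (a n)⁻¹)
      (fun n => (inv_pos.mpr (ha0 n)).le) fun n => by simpa using hinv n
  have hRe : ∀ n, R (e n) = ((√(a n))⁻¹ : ℝ) • e n := fun n => by
    refine ContinuousLinearMap.apply_eq_smul_of_sq (CFC.sqrt_nonneg _)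
      (inv_pos.mpr (Real.sqrt_pos.mpr (ha0 n))) ?_
    rw [← mul_apply_eq_comp, hR, CFC.sqrt_mul_sqrt_self _ hinv0, hinv, inv_pow,
      Real.sq_sqrt (ha0 n).le, Complex.ofReal_inv]
  set c : ℕ → ℝ := fun n => √(1 - q ^ (2 * (n + 1))) with hc
  have hc2 : ∀ n, (c n : ℂ) * c n = 1 - (q : ℂ) ^ (2 * (n + 1)) := fun n => by
    have : 0 ≤ 1 - q ^ (2 * (n + 1)) := sub_nonneg.mpr (pow_le_one₀ hq0.le hq1.le)
    rw [← Complex.ofReal_mul, hc, Real.mul_self_sqrt this]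
    push_cast
    rfl
  have hze : ∀ n, z (e n) = (c n : ℂ) • e (n + 1) := fun n => by
    rw [hz, smul_apply, mul_apply_eq_comp, hRe,
      ← Complex.coe_smul, map_smul, hHm, smul_smul, smul_smul]
    congr 1
    rw [Real.sqrt_mul (ha0 n).le]
    norm_cast
    have := (Real.sqrt_pos.mpr (ha0 n)).ne'
    simp only [ha, hc] at this ⊢
    field_simp
  have hzz : ∀ n, (star z * z) (e n) = (1 - (q : ℂ) ^ (2 * (n + 1))) • e n := fun n => by
    rw [mul_apply_eq_comp, hze, map_smul,
      star_apply_succ_of_weighted_shift he htotal hze, smul_smul, hc2]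
  have hzz' : ∀ n, (z * star z) (e n) = (1 - (q : ℂ) ^ (2 * n)) • e n := fun n => by
    rw [mul_apply_eq_comp]
    cases n with
    | zero => simp [star_apply_zero_of_weighted_shift he htotal hze]
    | succ n =>
      rw [star_apply_succ_of_weighted_shift he htotal hze, map_smul, hze, smul_smul, hc2]
  constructor
  · refine hext _ _ fun n => ?_
    simp only [sub_apply, smul_apply, hzz, hzz',
      one_apply_eq_self]
    push_cast
    module
  · refine hext _ _ fun n => ?_
    simp only [sub_apply, smul_apply, hzz, hzz', hZm,
      ← sub_smul, smul_smul]
    congr 1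
    have hq : (q : ℂ) ≠ 0 := Complex.ofReal_ne_zero.mpr hq0.ne'
    have hq2 : (1 : ℂ) - (q : ℂ) ^ 2 ≠ 0 := by
      norm_cast
      nlinarith
    rw [zpow_neg, show ((2 : ℤ)) = ((2 : ℕ) : ℤ) from rfl, zpow_natCast]
    push_cast
    have h : ((q : ℂ) ^ 2)⁻¹ - 1 = (1 - (q : ℂ) ^ 2) / (q : ℂ) ^ 2 := by field_simp
    rw [h, inv_div]
    field_simp
    ring
end
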